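/- Let k be a field, H a coquasi-bialgebra over k with preantipode S, and V a finite-dimensional left H-comodule with dual basis ∑_i vⁱ ⊗ v_i ∈ V* ⊗ V. Set V^⋆ := (V* ⊗ H)^{coH} = { x ∈ V* ⊗ H : ρʳ(x) = x ⊗ 1_H }. Then: (a) the assignment ρ_{V^⋆}(∑_t f_t ⊗ b_t) := ∑_t (b_t)₁ ⊗ (f_t ⊗ (b_t)₂) is a well-defined left H-comodule structure on V^⋆; (b) the element db_V(1) := ∑_i (vⁱ₀ ⊗ S(vⁱ₁)) ⊗ v_i lies in V^⋆ ⊗ V (where f ↦ ∑ f₀ ⊗ f₁ is the right coaction on V*), and the maps ev_V : V ⊗ V^⋆ → k, u ⊗ (∑_t f_t ⊗ b_t) ↦ ∑_t f_t(u) ε(b_t), and db_V : k → V^⋆ ⊗ V are morphisms of left H-comodules (with diagonal coactions on tensor products and trivial coaction on k); (c) the zig-zag identities hold with respect to the associator a_{U,V,W}(u ⊗ v ⊗ w) = ∑ ω⁻¹(u₋₁ ⊗ v₋₁ ⊗ w₋₁) u₀ ⊗ v₀ ⊗ w₀: namely (ev_V ⊗ V)(a⁻¹_{V,V^⋆,V}(v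 ⊗ db_V(1))) = v for all v ∈ V and (V^⋆ ⊗ ev_V)(a_{V^⋆,V,V^⋆}(db_V(1) ⊗ x)) = x for all x ∈ V^⋆. In particular, V^⋆ is a right dual of V in the monoidal category of finite-dimensional left H-comodules. -/

import Mathlib

open scoped TensorProduct
open TensorProduct

/-- A coquasi-bialgebra structure on a coassociative counital `k`-coalgebra `H`:
a multiplication `mul` (a coalgebra morphism, given in curried bilinear form), a unit `one`,
and a convolution-invertible trilinear reassociator `ω` (with convolution inverse `ωInv`),
subject to the cocycle condition, unitality, and quasi-associativity.
Sweedler-type identities are stated for arbitrary finite representations of the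
comultiplications involved. -/
structure CoquasiBialgebra (k H : Type*) [CommRing k] [AddCommGroup H] [Module k H]
    [Coalgebra k H] where
  mul : H →ₗ[k] H →ₗ[k] H
  one : H
  ω : H →ₗ[k] H →ₗ[k] H →ₗ[k] k
  ωInv : H →ₗ[k] H →ₗ[k] H →ₗ[k] k
  /-- `mul` is comultiplicative: `Δ(xy) = ∑ x₁y₁ ⊗ x₂y₂`. -/
  comul_mul : ∀ (x y : H) (n m : ℕ) (x1 x2 : Fin n → H) (y1 y2 : Fin m → H),
    Coalgebra.comul (R := k) x = ∑ i, x1 i ⊗ₜ[k] x2 i →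
    Coalgebra.comul (R := k) y = ∑ j, y1 j ⊗ₜ[k] y2 j →
    Coalgebra.comul (R := k) (mul x y) =
      ∑ i, ∑ j, mul (x1 i) (y1 j) ⊗ₜ[k] mul (x2 i) (y2 j)
  counit_mul : ∀ x y, Coalgebra.counit (R := k) (mul x y) =
      Coalgebra.counit (R := k) x * Coalgebra.counit (R := k) y
  comul_one : Coalgebra.comul (R := k) one = one ⊗ₜ[k] one
  counit_one : Coalgebra.counit (R := k) one = 1
  one_mul : ∀ h, mul one h = h
  mul_one : ∀ h, mul h one = h
  /-- `ω(x ⊗ 1 ⊗ y) = ε(x)ε(y)`. -/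
  ω_one : ∀ x y, ω x one y = Coalgebra.counit (R := k) x * Coalgebra.counit (R := k) y
  /-- `ωInv` is the two-sided convolution inverse of `ω`. -/
  ω_conv_inv : ∀ (x y z : H) (n m p : ℕ) (x1 x2 : Fin n → H) (y1 y2 : Fin m → H)
    (z1 z2 : Fin p → H),
    Coalgebra.comul (R := k) x = ∑ i, x1 i ⊗ₜ[k] x2 i →
    Coalgebra.comul (R := k) y = ∑ j, y1 j ⊗ₜ[k] y2 j →
    Coalgebra.comul (R := k) z = ∑ l, z1 l ⊗ₜ[k] z2 l →
    (∑ i, ∑ j, ∑ l, ω (x1 i) (y1 j) (z1 l) * ωInv (x2 i) (y2 j) (z2 l) =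
      Coalgebra.counit (R := k) x * Coalgebra.counit (R := k) y *
        Coalgebra.counit (R := k) z) ∧
    (∑ i, ∑ j, ∑ l, ωInv (x1 i) (y1 j) (z1 l) * ω (x2 i) (y2 j) (z2 l) =
      Coalgebra.counit (R := k) x * Coalgebra.counit (R := k) y *
        Coalgebra.counit (R := k) z)
  /-- The 3-cocycle condition:
  `∑ ω(x₁ ⊗ y₁ ⊗ z₁w₁) ω(x₂y₂ ⊗ z₂ ⊗ w₂)
    = ∑ ω(y₁ ⊗ z₁ ⊗ w₁) ω(x₁ ⊗ y₂z₂ ⊗ w₂) ω(x₂ ⊗ y₃ ⊗ z₃)`. -/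
  cocycle : ∀ (x y z w : H) (nx ny nz nw : ℕ)
    (x1 x2 : Fin nx → H) (y1 y2 : Fin ny → H) (z1 z2 : Fin nz → H) (w1 w2 : Fin nw → H)
    (my : Fin ny → ℕ) (y21 y22 : ∀ j, Fin (my j) → H)
    (mz : Fin nz → ℕ) (z21 z22 : ∀ l, Fin (mz l) → H),
    Coalgebra.comul (R := k) x = ∑ i, x1 i ⊗ₜ[k] x2 i →
    Coalgebra.comul (R := k) y = ∑ j, y1 j ⊗ₜ[k] y2 j →
    Coalgebra.comul (R := k) z = ∑ l, z1 l ⊗ₜ[k] z2 l →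
    Coalgebra.comul (R := k) w = ∑ r, w1 r ⊗ₜ[k] w2 r →
    (∀ j, Coalgebra.comul (R := k) (y2 j) = ∑ p, y21 j p ⊗ₜ[k] y22 j p) →
    (∀ l, Coalgebra.comul (R := k) (z2 l) = ∑ q, z21 l q ⊗ₜ[k] z22 l q) →
    ∑ i, ∑ j, ∑ l, ∑ r,
        ω (x1 i) (y1 j) (mul (z1 l) (w1 r)) * ω (mul (x2 i) (y2 j)) (z2 l) (w2 r) =
      ∑ i, ∑ j, ∑ p, ∑ l, ∑ q, ∑ r,
        ω (y1 j) (z1 l) (w1 r) * ω (x1 i) (mul (y21 j p) (z21 l q)) (w2 r) *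
          ω (x2 i) (y22 j p) (z22 l q)
  /-- Quasi-associativity: `∑ x₁(y₁z₁) ω(x₂ ⊗ y₂ ⊗ z₂) = ∑ ω(x₁ ⊗ y₁ ⊗ z₁) (x₂y₂)z₂`. -/
  quasi_assoc : ∀ (x y z : H) (n m p : ℕ) (x1 x2 : Fin n → H) (y1 y2 : Fin m → H)
    (z1 z2 : Fin p → H),
    Coalgebra.comul (R := k) x = ∑ i, x1 i ⊗ₜ[k] x2 i →
    Coalgebra.comul (R := k) y = ∑ j, y1 j ⊗ₜ[k] y2 j →
    Coalgebra.comul (R := k) z = ∑ l, z1 l ⊗ₜ[k] z2 l →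
    ∑ i, ∑ j, ∑ l, ω (x2 i) (y2 j) (z2 l) • mul (x1 i) (mul (y1 j) (z1 l)) =
      ∑ i, ∑ j, ∑ l, ω (x1 i) (y1 j) (z1 l) • mul (mul (x2 i) (y2 j)) (z2 l)

/-- A preantipode for a coquasi-bialgebra: a `k`-linear endomorphism `S` with
(P1) `∑ S(h₁)₁h₂ ⊗ S(h₁)₂ = 1 ⊗ S(h)`, (P2) `∑ S(h₂)₁ ⊗ h₁S(h₂)₂ = S(h) ⊗ 1`,
(P3) `∑ ω(h₁ ⊗ S(h₂) ⊗ h₃) = ε(h)`. -/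
def CoquasiBialgebra.IsPreantipode {k H : Type*} [CommRing k] [AddCommGroup H] [Module k H]
    [Coalgebra k H] (B : CoquasiBialgebra k H) (S : H →ₗ[k] H) : Prop :=
  (∀ (h : H) (n : ℕ) (a b : Fin n → H) (m : Fin n → ℕ) (c d : ∀ i, Fin (m i) → H),
    Coalgebra.comul (R := k) h = ∑ i, a i ⊗ₜ[k] b i →
    (∀ i, Coalgebra.comul (R := k) (S (a i)) = ∑ p, c i p ⊗ₜ[k] d i p) →
    ∑ i, ∑ p, B.mul (c i p) (b i) ⊗ₜ[k] d i p = B.one ⊗ₜ[k] S h) ∧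
  (∀ (h : H) (n : ℕ) (a b : Fin n → H) (m : Fin n → ℕ) (c d : ∀ i, Fin (m i) → H),
    Coalgebra.comul (R := k) h = ∑ i, a i ⊗ₜ[k] b i →
    (∀ i, Coalgebra.comul (R := k) (S (b i)) = ∑ p, c i p ⊗ₜ[k] d i p) →
    ∑ i, ∑ p, c i p ⊗ₜ[k] B.mul (a i) (d i p) = S h ⊗ₜ[k] B.one) ∧
  (∀ (h : H) (n : ℕ) (a b : Fin n → H) (m : Fin n → ℕ) (c d : ∀ i, Fin (m i) → H),
    Coalgebra.comul (R := k) h = ∑ i, a i ⊗ₜ[k] b i →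
    (∀ i, Coalgebra.comul (R := k) (b i) = ∑ p, c i p ⊗ₜ[k] d i p) →
    ∑ i, ∑ p, B.ω (a i) (S (c i p)) (d i p) = Coalgebra.counit (R := k) h)

section Statement16

open LinearMap

variable {k H : Type*} [Field k] [AddCommGroup H] [Module k H] [Coalgebra k H]

/-- The ambient right `H`-coaction on `V* ⊗ H`, `f ⊗ b ↦ ∑ (f₀ ⊗ b₁) ⊗ f₁b₂`, built from a
right coaction `ρdual` on `V*`. -/
noncomputable def ambientRightCoaction (B : CoquasiBialgebra k H) {V : Type*}
    [AddCommGroup V] [Module k V]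
    (ρdual : (V →ₗ[k] k) →ₗ[k] (V →ₗ[k] k) ⊗[k] H) :
    ((V →ₗ[k] k) ⊗[k] H) →ₗ[k] ((V →ₗ[k] k) ⊗[k] H) ⊗[k] H :=
  LinearMap.lTensor ((V →ₗ[k] k) ⊗[k] H) (TensorProduct.lift B.mul) ∘ₗ
    (TensorProduct.tensorTensorTensorComm k (V →ₗ[k] k) H H H).toLinearMap ∘ₗ
    LinearMap.rTensor (H ⊗[k] H) ρdual ∘ₗ
    LinearMap.lTensor (V →ₗ[k] k) (Coalgebra.comul (R := k) (A := H))

/-- The coinvariant subspace `V^⋆ = (V* ⊗ H)^{coH} = {x | ρʳ(x) = x ⊗ 1}`. -/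
noncomputable def coinvariants (B : CoquasiBialgebra k H) {V : Type*}
    [AddCommGroup V] [Module k V]
    (ρdual : (V →ₗ[k] k) →ₗ[k] (V →ₗ[k] k) ⊗[k] H) :
    Submodule k ((V →ₗ[k] k) ⊗[k] H) :=
  LinearMap.eqLocus (ambientRightCoaction B ρdual)
    ((TensorProduct.mk k ((V →ₗ[k] k) ⊗[k] H) H).flip B.one)

/-- The ambient left `H`-coaction on `V* ⊗ H`, `f ⊗ b ↦ ∑ b₁ ⊗ (f ⊗ b₂)`. -/
noncomputable def ambientLeftCoaction {V : Type*} [AddCommGroup V] [Module k V] :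
    ((V →ₗ[k] k) ⊗[k] H) →ₗ[k] H ⊗[k] ((V →ₗ[k] k) ⊗[k] H) :=
  (TensorProduct.assoc k H (V →ₗ[k] k) H).toLinearMap ∘ₗ
    LinearMap.rTensor H (TensorProduct.comm k (V →ₗ[k] k) H).toLinearMap ∘ₗ
    (TensorProduct.assoc k (V →ₗ[k] k) H H).symm.toLinearMap ∘ₗ
    LinearMap.lTensor (V →ₗ[k] k) (Coalgebra.comul (R := k) (A := H))

/-- The evaluation `V ⊗ (V* ⊗ H) → k`, `u ⊗ (f ⊗ b) ↦ f(u) ε(b)`. -/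
noncomputable def ambientEv {V : Type*} [AddCommGroup V] [Module k V] :
    (V ⊗[k] ((V →ₗ[k] k) ⊗[k] H)) →ₗ[k] k :=
  (TensorProduct.lid k k).toLinearMap ∘ₗ
    TensorProduct.map (TensorProduct.lift (LinearMap.id (R := k) (M := V →ₗ[k] k)).flip)
      (Coalgebra.counit (R := k) (A := H)) ∘ₗ
    (TensorProduct.assoc k V (V →ₗ[k] k) H).symm.toLinearMap

section ConvolutionIdentities

open WithConv

theorem exists_fin_sum_tmul {R M N : Type*} [CommSemiring R] [AddCommMonoid M] [AddCommMonoid N]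
    [Module R M] [Module R N] (t : M ⊗[R] N) :
    ∃ (n : ℕ) (a : Fin n → M) (b : Fin n → N), t = ∑ i, a i ⊗ₜ[R] b i := by
  obtain ⟨s, hs⟩ := TensorProduct.exists_finset t
  refine ⟨s.card, fun i => (s.equivFin.symm i).1.1, fun i => (s.equivFin.symm i).1.2, ?_⟩
  rw [hs, ← Finset.sum_coe_sort]
  exact (Equiv.sum_comp s.equivFin.symm (fun p : s => p.1.1 ⊗ₜ[R] p.1.2)).symm

theorem sum_counit_smul_of_comul_eq {x : H} {α : Type*} [Fintype α] {x1 x2 : α → H}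
    (hx : Coalgebra.comul (R := k) x = ∑ i, x1 i ⊗ₜ[k] x2 i) :
    ∑ i, Coalgebra.counit (R := k) (x1 i) • x2 i = x := by
  have h := congrArg (TensorProduct.lid k H) (Coalgebra.rTensor_counit_comul (R := k) x)
  simpa [hx] using h

theorem sum_counit_smul_of_comul_eq' {x : H} {α : Type*} [Fintype α] {x1 x2 : α → H}
    (hx : Coalgebra.comul (R := k) x = ∑ i, x1 i ⊗ₜ[k] x2 i) :
    ∑ i, Coalgebra.counit (R := k) (x2 i) • x1 i = x := by
  have h := congrArg (TensorProduct.rid k H) (Coalgebra.lTensor_counit_comul (R := k) x)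
  simpa [hx] using h

theorem sum_counit_mul_of_comul_eq (f : H →ₗ[k] k) {x : H} {α : Type*} [Fintype α]
    {x1 x2 : α → H} (hx : Coalgebra.comul (R := k) x = ∑ i, x1 i ⊗ₜ[k] x2 i) :
    ∑ i, Coalgebra.counit (R := k) (x1 i) * f (x2 i) = f x := by
  simpa using congrArg f (sum_counit_smul_of_comul_eq hx)

theorem sum_mul_counit_of_comul_eq (f : H →ₗ[k] k) {x : H} {α : Type*} [Fintype α]
    {x1 x2 : α → H} (hx : Coalgebra.comul (R := k) x = ∑ i, x1 i ⊗ₜ[k] x2 i) :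
    ∑ i, f (x1 i) * Coalgebra.counit (R := k) (x2 i) = f x := by
  simpa [mul_comm] using congrArg f (sum_counit_smul_of_comul_eq' hx)

theorem convMul_apply_tmul_tmul (f g : WithConv (H ⊗[k] H →ₗ[k] k)) {x y : H}
    {α β : Type*} [Fintype α] [Fintype β] {x1 x2 : α → H} {y1 y2 : β → H}
    (hx : Coalgebra.comul (R := k) x = ∑ i, x1 i ⊗ₜ[k] x2 i)
    (hy : Coalgebra.comul (R := k) y = ∑ i, y1 i ⊗ₜ[k] y2 i) :
    (f * g) (x ⊗ₜ y) = ∑ i, ∑ j, f (x1 i ⊗ₜ y1 j) * g (x2 i ⊗ₜ y2 j) := by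
  simp only [LinearMap.convMul_apply, TensorProduct.comul_tmul, hx, hy, TensorProduct.sum_tmul,
    TensorProduct.tmul_sum, map_sum, TensorProduct.AlgebraTensorModule.tensorTensorTensorComm_tmul,
    TensorProduct.map_tmul, LinearMap.mul'_apply]
  first | rfl | exact Finset.sum_comm

theorem sum_reverse₄ {M α β γ δ : Type*} [AddCommMonoid M] [Fintype α] [Fintype β] [Fintype γ]
    [Fintype δ] (F : α → β → γ → δ → M) :
    ∑ d, ∑ c, ∑ b, ∑ a, F a b c d = ∑ a, ∑ b, ∑ c, ∑ d, F a b c d := by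
  calc _ = ∑ p : δ × γ × β × α, F p.2.2.2 p.2.2.1 p.2.1 p.1 := by
        simp only [Fintype.sum_prod_type]
    _ = ∑ p : α × β × γ × δ, F p.1 p.2.1 p.2.2.1 p.2.2.2 :=
        Fintype.sum_equiv ⟨fun p => (p.2.2.2, p.2.2.1, p.2.1, p.1),
          fun p => (p.2.2.2, p.2.2.1, p.2.1, p.1), fun _ => rfl, fun _ => rfl⟩ _ _ fun _ => rfl
    _ = _ := by simp only [Fintype.sum_prod_type]

theorem sum_reverse₃ {M α β γ : Type*} [AddCommMonoid M] [Fintype α] [Fintype β] [Fintype γ]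
    (F : α → β → γ → M) : ∑ c, ∑ b, ∑ a, F a b c = ∑ a, ∑ b, ∑ c, F a b c := by
  simpa using sum_reverse₄ fun (a : α) (b : β) (c : γ) (_ : Fin 1) => F a b c

theorem convMul_apply_tmul₃ (f g : WithConv (H ⊗[k] (H ⊗[k] H) →ₗ[k] k))
    {x y z : H} {α β γ : Type*} [Fintype α] [Fintype β] [Fintype γ]
    {x1 x2 : α → H} {y1 y2 : β → H} {z1 z2 : γ → H}
    (hx : Coalgebra.comul (R := k) x = ∑ i, x1 i ⊗ₜ[k] x2 i)
    (hy : Coalgebra.comul (R := k) y = ∑ i, y1 i ⊗ₜ[k] y2 i)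
    (hz : Coalgebra.comul (R := k) z = ∑ i, z1 i ⊗ₜ[k] z2 i) :
    (f * g) (x ⊗ₜ (y ⊗ₜ z)) = ∑ i, ∑ j, ∑ l,
      f (x1 i ⊗ₜ (y1 j ⊗ₜ z1 l)) * g (x2 i ⊗ₜ (y2 j ⊗ₜ z2 l)) := by
  simp only [LinearMap.convMul_apply, TensorProduct.comul_tmul, hx, hy, hz,
    TensorProduct.sum_tmul,
    TensorProduct.tmul_sum, map_sum, TensorProduct.AlgebraTensorModule.tensorTensorTensorComm_tmul,
    TensorProduct.map_tmul, LinearMap.mul'_apply]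
  exact sum_reverse₃ _

theorem convMul_apply_tmul₄ (f g : WithConv (H ⊗[k] (H ⊗[k] (H ⊗[k] H)) →ₗ[k] k))
    {x y z w : H} {α β γ δ : Type*} [Fintype α] [Fintype β] [Fintype γ] [Fintype δ]
    {x1 x2 : α → H} {y1 y2 : β → H} {z1 z2 : γ → H} {w1 w2 : δ → H}
    (hx : Coalgebra.comul (R := k) x = ∑ i, x1 i ⊗ₜ[k] x2 i)
    (hy : Coalgebra.comul (R := k) y = ∑ i, y1 i ⊗ₜ[k] y2 i)
    (hz : Coalgebra.comul (R := k) z = ∑ i, z1 i ⊗ₜ[k] z2 i)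
    (hw : Coalgebra.comul (R := k) w = ∑ i, w1 i ⊗ₜ[k] w2 i) :
    (f * g) (x ⊗ₜ (y ⊗ₜ (z ⊗ₜ w))) = ∑ i, ∑ j, ∑ l, ∑ r,
      f (x1 i ⊗ₜ (y1 j ⊗ₜ (z1 l ⊗ₜ w1 r))) * g (x2 i ⊗ₜ (y2 j ⊗ₜ (z2 l ⊗ₜ w2 r))) := by
  simp only [LinearMap.convMul_apply, TensorProduct.comul_tmul, hx, hy, hz, hw,
    TensorProduct.sum_tmul,
    TensorProduct.tmul_sum, map_sum, TensorProduct.AlgebraTensorModule.tensorTensorTensorComm_tmul,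
    TensorProduct.map_tmul, LinearMap.mul'_apply]
  exact sum_reverse₄ _

namespace CoquasiBialgebra

variable (B : CoquasiBialgebra k H)

theorem comul_one_eq_sum :
    Coalgebra.comul (R := k) B.one = ∑ _i : Fin 1, B.one ⊗ₜ[k] B.one := by
  simp [B.comul_one]

theorem ω_one_left (y z : H) :
    B.ω B.one y z = Coalgebra.counit (R := k) y * Coalgebra.counit (R := k) z := by
  let u : WithConv (H ⊗[k] H →ₗ[k] k) := toConv (TensorProduct.lift (B.ω B.one))
  let v : WithConv (H ⊗[k] H →ₗ[k] k) := toConv (TensorProduct.lift (B.ωInv B.one))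
  have h1 := B.comul_one_eq_sum
  have huu : u * u = u := by
    ext y z
    obtain ⟨ny, y1, y2, hy⟩ := exists_fin_sum_tmul (Coalgebra.comul (R := k) y)
    obtain ⟨nz, z1, z2, hz⟩ := exists_fin_sum_tmul (Coalgebra.comul (R := k) z)
    choose my y21 y22 hy2 using fun l => exists_fin_sum_tmul (Coalgebra.comul (R := k) (y2 l))
    have h := B.cocycle B.one B.one y z _ _ _ _ _ _ _ _ _ _ _ _ (fun _ => 1) (fun _ _ => B.one)
      (fun _ _ => B.one) _ _ _ h1 h1 hy hz (fun _ => h1) hy2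
    simp only [Finset.univ_unique, Finset.sum_const, Finset.card_singleton, one_smul, B.one_mul,
      B.counit_one, B.ω_one, B.counit_mul, _root_.one_mul] at h
    calc (u * u) (y ⊗ₜ z)
        = ∑ l, ∑ r, B.ω B.one (y1 l) (z1 r) * B.ω B.one (y2 l) (z2 r) :=
          convMul_apply_tmul_tmul u u hy hz
      _ = ∑ l, ∑ q, ∑ r, B.ω B.one (y1 l) (z1 r) * B.ω B.one (y21 l q) (z2 r) *
            Coalgebra.counit (R := k) (y22 l q) := by
          refine Finset.sum_congr rfl fun l _ => ?_
          rw [Finset.sum_comm]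
          refine Finset.sum_congr rfl fun r _ => ?_
          have := sum_mul_counit_of_comul_eq ((B.ω B.one).flip (z2 r)) (hy2 l)
          simp only [LinearMap.flip_apply] at this
          simp only [mul_assoc, ← Finset.mul_sum, this]
      _ = ∑ l, ∑ r, Coalgebra.counit (R := k) (y1 l) * (Coalgebra.counit (R := k) (z1 r) *
            B.ω B.one (y2 l) (z2 r)) := by rw [← h]; simp only [mul_assoc]
      _ = B.ω B.one y z := by
          simp only [← Finset.mul_sum, sum_counit_mul_of_comul_eq (B.ω B.one _) hz]
          exact sum_counit_mul_of_comul_eq ((B.ω B.one).flip z) hy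
  have hvu : v * u = 1 := by
    ext y z
    obtain ⟨ny, y1, y2, hy⟩ := exists_fin_sum_tmul (Coalgebra.comul (R := k) y)
    obtain ⟨nz, z1, z2, hz⟩ := exists_fin_sum_tmul (Coalgebra.comul (R := k) z)
    have := (B.ω_conv_inv B.one y z _ _ _ _ _ _ _ _ _ h1 hy hz).2
    simp only [Finset.univ_unique, Finset.sum_const, Finset.card_singleton, one_smul,
      B.counit_one, _root_.one_mul] at this
    simpa [convMul_apply_tmul_tmul v u hy hz, u, v, mul_comm] using this
  have hu : u = 1 := by
    calc u = v * u * u := by rw [hvu, _root_.one_mul]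
      _ = 1 := by rw [mul_assoc, huu, hvu]
  simpa [u, mul_comm] using congrArg (fun f => f.ofConv (y ⊗ₜ z)) hu

theorem ω_one_right (x y : H) :
    B.ω x y B.one = Coalgebra.counit (R := k) x * Coalgebra.counit (R := k) y := by
  let u : WithConv (H ⊗[k] H →ₗ[k] k) :=
    toConv (TensorProduct.lift (B.ω.compr₂ (LinearMap.applyₗ B.one)))
  let v : WithConv (H ⊗[k] H →ₗ[k] k) :=
    toConv (TensorProduct.lift (B.ωInv.compr₂ (LinearMap.applyₗ B.one)))
  have h1 := B.comul_one_eq_sum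
  have huu : u * u = u := by
    ext x y
    obtain ⟨nx, x1, x2, hx⟩ := exists_fin_sum_tmul (Coalgebra.comul (R := k) x)
    obtain ⟨ny, y1, y2, hy⟩ := exists_fin_sum_tmul (Coalgebra.comul (R := k) y)
    choose my y21 y22 hy2 using fun l => exists_fin_sum_tmul (Coalgebra.comul (R := k) (y2 l))
    have h := B.cocycle x y B.one B.one _ _ _ _ _ _ _ _ _ _ _ _ _ _ _ (fun _ => 1)
      (fun _ _ => B.one) (fun _ _ => B.one) hx hy h1 h1 hy2 (fun _ => h1)
    simp only [Finset.univ_unique, Finset.sum_const, Finset.card_singleton, one_smul, B.mul_one,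
      B.counit_one, B.ω_one, B.counit_mul, _root_.mul_one] at h
    calc (u * u) (x ⊗ₜ y)
        = ∑ i, ∑ j, B.ω (x1 i) (y1 j) B.one * B.ω (x2 i) (y2 j) B.one :=
          convMul_apply_tmul_tmul u u hx hy
      _ = ∑ i, ∑ j, ∑ p, Coalgebra.counit (R := k) (y1 j) *
            B.ω (x1 i) (y21 j p) B.one * B.ω (x2 i) (y22 j p) B.one := by
          have huu2 (j) := convMul_apply_tmul_tmul u u hx (hy2 j)
          refine (convMul_apply_tmul_tmul u u hx hy).symm.trans ?_
          rw [Finset.sum_comm]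
          refine (sum_counit_mul_of_comul_eq ((u * u).ofConv ∘ₗ TensorProduct.mk k H H x)
            hy).symm.trans (Finset.sum_congr rfl fun j _ => ?_)
          simp only [LinearMap.comp_apply, TensorProduct.mk_apply, huu2, Finset.mul_sum, mul_assoc]
          rfl
      _ = ∑ i, ∑ j, (B.ω (x1 i) (y1 j) B.one * Coalgebra.counit (R := k) (y2 j)) *
            Coalgebra.counit (R := k) (x2 i) := by
          rw [← h]; simp only [mul_assoc, mul_comm]
      _ = B.ω x y B.one := by
          have this (i) := sum_mul_counit_of_comul_eq ((B.ω (x1 i)).flip B.one) hy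
          simp only [LinearMap.flip_apply] at this
          simp only [← Finset.sum_mul, this]
          exact sum_mul_counit_of_comul_eq ((B.ω.flip y).flip B.one) hx
  have hvu : v * u = 1 := by
    ext x y
    obtain ⟨nx, x1, x2, hx⟩ := exists_fin_sum_tmul (Coalgebra.comul (R := k) x)
    obtain ⟨ny, y1, y2, hy⟩ := exists_fin_sum_tmul (Coalgebra.comul (R := k) y)
    have := (B.ω_conv_inv x y B.one _ _ _ _ _ _ _ _ _ hx hy h1).2
    simp only [Finset.univ_unique, Finset.sum_const, Finset.card_singleton, one_smul,
      B.counit_one, _root_.mul_one] at this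
    simpa [convMul_apply_tmul_tmul v u hx hy, u, v, mul_comm] using this
  have hu : u = 1 := by
    calc u = v * u * u := by rw [hvu, _root_.one_mul]
      _ = 1 := by rw [mul_assoc, huu, hvu]
  simpa [u, mul_comm] using congrArg (fun f => f.ofConv (x ⊗ₜ y)) hu

/-- The trilinear form `f` viewed on `H ⊗ (H ⊗ H)`. -/
noncomputable def uncurry₃ (f : H →ₗ[k] H →ₗ[k] H →ₗ[k] k) : H ⊗[k] (H ⊗[k] H) →ₗ[k] k :=
  TensorProduct.lift ((TensorProduct.lift.equiv (.id k) H H k).toLinearMap ∘ₗ f)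

@[simp]
theorem uncurry₃_tmul {k H : Type*} [Field k] [AddCommGroup H] [Module k H]
    (f : H →ₗ[k] H →ₗ[k] H →ₗ[k] k) (x y z : H) :
    uncurry₃ f (x ⊗ₜ (y ⊗ₜ z)) = f x y z := by
  simp [uncurry₃]

/-- The linear form `x ⊗ y ⊗ z ⊗ w ↦ f(y ⊗ z ⊗ w)ε(x)`. -/
noncomputable def formLast (f : H →ₗ[k] H →ₗ[k] H →ₗ[k] k) :
    WithConv (H ⊗[k] (H ⊗[k] (H ⊗[k] H)) →ₗ[k] k) :=
  toConv (uncurry₃ f ∘ₗ (TensorProduct.lid k _).toLinearMap ∘ₗ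
    LinearMap.rTensor _ (Coalgebra.counit (R := k) (A := H)))

/-- The linear form `x ⊗ y ⊗ z ⊗ w ↦ f(x ⊗ y ⊗ z)ε(w)`. -/
noncomputable def formFirst (f : H →ₗ[k] H →ₗ[k] H →ₗ[k] k) :
    WithConv (H ⊗[k] (H ⊗[k] (H ⊗[k] H)) →ₗ[k] k) :=
  toConv (uncurry₃ f ∘ₗ LinearMap.lTensor H (LinearMap.lTensor H
    ((TensorProduct.rid k _).toLinearMap ∘ₗ
      LinearMap.lTensor _ (Coalgebra.counit (R := k) (A := H)))))

/-- The linear form `x ⊗ y ⊗ z ⊗ w ↦ ω(x ⊗ y ⊗ zw)`. -/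
noncomputable def formMulRight : WithConv (H ⊗[k] (H ⊗[k] (H ⊗[k] H)) →ₗ[k] k) :=
  toConv (uncurry₃ B.ω ∘ₗ LinearMap.lTensor H (LinearMap.lTensor H (TensorProduct.lift B.mul)))

/-- The linear form `x ⊗ y ⊗ z ⊗ w ↦ ω(x ⊗ yz ⊗ w)`. -/
noncomputable def formMulMiddle : WithConv (H ⊗[k] (H ⊗[k] (H ⊗[k] H)) →ₗ[k] k) :=
  toConv (uncurry₃ B.ω ∘ₗ LinearMap.lTensor H (LinearMap.rTensor H (TensorProduct.lift B.mul) ∘ₗ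
    (TensorProduct.assoc k H H H).symm.toLinearMap))

/-- The linear form `x ⊗ y ⊗ z ⊗ w ↦ ω(xy ⊗ z ⊗ w)`. -/
noncomputable def formMulLeft : WithConv (H ⊗[k] (H ⊗[k] (H ⊗[k] H)) →ₗ[k] k) :=
  toConv (uncurry₃ B.ω ∘ₗ LinearMap.rTensor (H ⊗[k] H) (TensorProduct.lift B.mul) ∘ₗ
    (TensorProduct.assoc k H H (H ⊗[k] H)).symm.toLinearMap)

@[simp]
theorem formLast_tmul (f : H →ₗ[k] H →ₗ[k] H →ₗ[k] k) (x y z w : H) :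
    formLast f (x ⊗ₜ (y ⊗ₜ (z ⊗ₜ w))) = Coalgebra.counit (R := k) x * f y z w := by
  simp [formLast]

@[simp]
theorem formFirst_tmul (f : H →ₗ[k] H →ₗ[k] H →ₗ[k] k) (x y z w : H) :
    formFirst f (x ⊗ₜ (y ⊗ₜ (z ⊗ₜ w))) = Coalgebra.counit (R := k) w * f x y z := by
  simp [formFirst]

@[simp]
theorem formMulRight_tmul (x y z w : H) :
    B.formMulRight (x ⊗ₜ (y ⊗ₜ (z ⊗ₜ w))) = B.ω x y (B.mul z w) := by
  simp [formMulRight]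

@[simp]
theorem formMulMiddle_tmul (x y z w : H) :
    B.formMulMiddle (x ⊗ₜ (y ⊗ₜ (z ⊗ₜ w))) = B.ω x (B.mul y z) w := by
  simp [formMulMiddle]

@[simp]
theorem formMulLeft_tmul (x y z w : H) :
    B.formMulLeft (x ⊗ₜ (y ⊗ₜ (z ⊗ₜ w))) = B.ω (B.mul x y) z w := by
  simp [formMulLeft]

theorem formMulMiddle_mul_formFirst_apply {x y z w : H}
    {α β γ : Type*} [Fintype α] [Fintype β] [Fintype γ]
    {x1 x2 : α → H} {y1 y2 : β → H} {z1 z2 : γ → H}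
    (hx : Coalgebra.comul (R := k) x = ∑ i, x1 i ⊗ₜ[k] x2 i)
    (hy : Coalgebra.comul (R := k) y = ∑ i, y1 i ⊗ₜ[k] y2 i)
    (hz : Coalgebra.comul (R := k) z = ∑ i, z1 i ⊗ₜ[k] z2 i) :
    (B.formMulMiddle * formFirst B.ω) (x ⊗ₜ (y ⊗ₜ (z ⊗ₜ w))) =
      ∑ i, ∑ j, ∑ l, B.ω (x1 i) (B.mul (y1 j) (z1 l)) w * B.ω (x2 i) (y2 j) (z2 l) := by
  obtain ⟨nw, w1, w2, hw⟩ := exists_fin_sum_tmul (Coalgebra.comul (R := k) w)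
  rw [convMul_apply_tmul₄ _ _ hx hy hz hw]
  simp only [formMulMiddle_tmul, formFirst_tmul, ← mul_assoc, ← Finset.sum_mul,
    sum_mul_counit_of_comul_eq _ hw]

theorem formLast_mul_apply (f : H →ₗ[k] H →ₗ[k] H →ₗ[k] k)
    (g : WithConv (H ⊗[k] (H ⊗[k] (H ⊗[k] H)) →ₗ[k] k)) {x y z w : H}
    {β γ δ : Type*} [Fintype β] [Fintype γ] [Fintype δ]
    {y1 y2 : β → H} {z1 z2 : γ → H} {w1 w2 : δ → H}
    (hy : Coalgebra.comul (R := k) y = ∑ i, y1 i ⊗ₜ[k] y2 i)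
    (hz : Coalgebra.comul (R := k) z = ∑ i, z1 i ⊗ₜ[k] z2 i)
    (hw : Coalgebra.comul (R := k) w = ∑ i, w1 i ⊗ₜ[k] w2 i) :
    (formLast f * g) (x ⊗ₜ (y ⊗ₜ (z ⊗ₜ w))) =
      ∑ j, ∑ l, ∑ r, f (y1 j) (z1 l) (w1 r) * g (x ⊗ₜ (y2 j ⊗ₜ (z2 l ⊗ₜ w2 r))) := by
  obtain ⟨nx, x1, x2, hx⟩ := exists_fin_sum_tmul (Coalgebra.comul (R := k) x)
  rw [convMul_apply_tmul₄ _ _ hx hy hz hw]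
  rw [Finset.sum_comm]; refine Finset.sum_congr rfl fun j _ => ?_
  rw [Finset.sum_comm]; refine Finset.sum_congr rfl fun l _ => ?_
  rw [Finset.sum_comm]; refine Finset.sum_congr rfl fun r _ => ?_
  have := sum_counit_mul_of_comul_eq
    (g.ofConv ∘ₗ (TensorProduct.mk k H _).flip (y2 j ⊗ₜ (z2 l ⊗ₜ w2 r))) hx
  simp only [LinearMap.comp_apply, LinearMap.flip_apply, TensorProduct.mk_apply] at this
  rw [← this, Finset.mul_sum]
  exact Finset.sum_congr rfl fun i _ => by rw [formLast_tmul]; ring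

theorem formMulRight_mul_formMulLeft :
    B.formMulRight * B.formMulLeft = formLast B.ω * (B.formMulMiddle * formFirst B.ω) := by
  ext x y z w
  obtain ⟨nx, x1, x2, hx⟩ := exists_fin_sum_tmul (Coalgebra.comul (R := k) x)
  obtain ⟨ny, y1, y2, hy⟩ := exists_fin_sum_tmul (Coalgebra.comul (R := k) y)
  obtain ⟨nz, z1, z2, hz⟩ := exists_fin_sum_tmul (Coalgebra.comul (R := k) z)
  obtain ⟨nw, w1, w2, hw⟩ := exists_fin_sum_tmul (Coalgebra.comul (R := k) w)
  choose my y21 y22 hy2 using fun j => exists_fin_sum_tmul (Coalgebra.comul (R := k) (y2 j))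
  choose mz z21 z22 hz2 using fun j => exists_fin_sum_tmul (Coalgebra.comul (R := k) (z2 j))
  have h := B.cocycle x y z w _ _ _ _ _ _ _ _ _ _ _ _ _ _ _ _ _ _ hx hy hz hw hy2 hz2
  have hl := convMul_apply_tmul₄ B.formMulRight B.formMulLeft hx hy hz hw
  have hr := formLast_mul_apply (x := x) B.ω (B.formMulMiddle * formFirst B.ω) hy hz hw
  simp only [formMulRight_tmul, formMulLeft_tmul] at hl
  have hr' (j l r) := B.formMulMiddle_mul_formFirst_apply (w := w2 r) hx (hy2 j) (hz2 l)
  simp only [hr', Finset.mul_sum] at hr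
  refine (hl.trans (h.trans ?_)).trans hr.symm
  rw [Finset.sum_comm]; refine Finset.sum_congr rfl fun j _ => ?_
  simp only [← mul_assoc]
  calc _ = ∑ i, ∑ p, ∑ l, ∑ r, ∑ q, B.ω (y1 j) (z1 l) (w1 r) *
        B.ω (x1 i) (B.mul (y21 j p) (z21 l q)) (w2 r) * B.ω (x2 i) (y22 j p) (z22 l q) :=
      Finset.sum_congr rfl fun i _ => Finset.sum_congr rfl fun p _ =>
        Finset.sum_congr rfl fun l _ => Finset.sum_comm
    _ = _ := by
      rw [Finset.sum_congr rfl fun i _ => Finset.sum_comm, Finset.sum_comm]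
      refine Finset.sum_congr rfl fun l _ => ?_
      rw [Finset.sum_congr rfl fun i _ => Finset.sum_comm, Finset.sum_comm]

theorem formLast_ωInv_mul_formLast_ω : formLast B.ωInv * formLast B.ω = 1 := by
  ext x y z w
  obtain ⟨ny, y1, y2, hy⟩ := exists_fin_sum_tmul (Coalgebra.comul (R := k) y)
  obtain ⟨nz, z1, z2, hz⟩ := exists_fin_sum_tmul (Coalgebra.comul (R := k) z)
  obtain ⟨nw, w1, w2, hw⟩ := exists_fin_sum_tmul (Coalgebra.comul (R := k) w)
  have h := (B.ω_conv_inv y z w _ _ _ _ _ _ _ _ _ hy hz hw).2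
  have hr := formLast_mul_apply (x := x) B.ωInv (formLast B.ω) hy hz hw
  simp only [formLast_tmul, mul_left_comm _ (Coalgebra.counit (R := k) x), ← Finset.mul_sum,
    h] at hr
  refine hr.trans ?_
  simp
  ring

theorem formLast_ωInv_mul :
    formLast B.ωInv * B.formMulRight * B.formMulLeft = B.formMulMiddle * formFirst B.ω := by
  rw [mul_assoc, formMulRight_mul_formMulLeft, ← mul_assoc, formLast_ωInv_mul_formLast_ω,
    _root_.one_mul]

/-- The linear form `x ⊗ y ⊗ z ↦ φ(x(yz))`. -/
noncomputable def formAssocRight (φ : H →ₗ[k] k) : WithConv (H ⊗[k] (H ⊗[k] H) →ₗ[k] k) :=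
  toConv (φ ∘ₗ TensorProduct.lift B.mul ∘ₗ LinearMap.lTensor H (TensorProduct.lift B.mul))

/-- The linear form `x ⊗ y ⊗ z ↦ φ((xy)z)`. -/
noncomputable def formAssocLeft (φ : H →ₗ[k] k) : WithConv (H ⊗[k] (H ⊗[k] H) →ₗ[k] k) :=
  toConv (φ ∘ₗ TensorProduct.lift B.mul ∘ₗ LinearMap.rTensor H (TensorProduct.lift B.mul) ∘ₗ
    (TensorProduct.assoc k H H H).symm.toLinearMap)

@[simp]
theorem formAssocRight_tmul (φ : H →ₗ[k] k) (x y z : H) :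
    B.formAssocRight φ (x ⊗ₜ (y ⊗ₜ z)) = φ (B.mul x (B.mul y z)) := by
  simp [formAssocRight]

@[simp]
theorem formAssocLeft_tmul (φ : H →ₗ[k] k) (x y z : H) :
    B.formAssocLeft φ (x ⊗ₜ (y ⊗ₜ z)) = φ (B.mul (B.mul x y) z) := by
  simp [formAssocLeft]

theorem ω_mul_ωInv : toConv (uncurry₃ B.ω) * toConv (uncurry₃ B.ωInv) = 1 := by
  ext x y z
  obtain ⟨nx, x1, x2, hx⟩ := exists_fin_sum_tmul (Coalgebra.comul (R := k) x)
  obtain ⟨ny, y1, y2, hy⟩ := exists_fin_sum_tmul (Coalgebra.comul (R := k) y)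
  obtain ⟨nz, z1, z2, hz⟩ := exists_fin_sum_tmul (Coalgebra.comul (R := k) z)
  have h := (B.ω_conv_inv x y z _ _ _ _ _ _ _ _ _ hx hy hz).1
  have h' := convMul_apply_tmul₃ (toConv (uncurry₃ B.ω)) (toConv (uncurry₃ B.ωInv)) hx hy hz
  simp only [uncurry₃_tmul, h] at h'
  refine h'.trans ?_
  simp
  ring

theorem ωInv_mul_ω : toConv (uncurry₃ B.ωInv) * toConv (uncurry₃ B.ω) = 1 := by
  ext x y z
  obtain ⟨nx, x1, x2, hx⟩ := exists_fin_sum_tmul (Coalgebra.comul (R := k) x)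
  obtain ⟨ny, y1, y2, hy⟩ := exists_fin_sum_tmul (Coalgebra.comul (R := k) y)
  obtain ⟨nz, z1, z2, hz⟩ := exists_fin_sum_tmul (Coalgebra.comul (R := k) z)
  have h := (B.ω_conv_inv x y z _ _ _ _ _ _ _ _ _ hx hy hz).2
  have h' := convMul_apply_tmul₃ (toConv (uncurry₃ B.ωInv)) (toConv (uncurry₃ B.ω)) hx hy hz
  simp only [uncurry₃_tmul, h] at h'
  refine h'.trans ?_
  simp
  ring

theorem formAssocRight_mul_ω (φ : H →ₗ[k] k) :
    B.formAssocRight φ * toConv (uncurry₃ B.ω) = toConv (uncurry₃ B.ω) * B.formAssocLeft φ := by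
  ext x y z
  obtain ⟨nx, x1, x2, hx⟩ := exists_fin_sum_tmul (Coalgebra.comul (R := k) x)
  obtain ⟨ny, y1, y2, hy⟩ := exists_fin_sum_tmul (Coalgebra.comul (R := k) y)
  obtain ⟨nz, z1, z2, hz⟩ := exists_fin_sum_tmul (Coalgebra.comul (R := k) z)
  have h := congrArg φ (B.quasi_assoc x y z _ _ _ _ _ _ _ _ _ hx hy hz)
  have h1 := convMul_apply_tmul₃ (B.formAssocRight φ) (toConv (uncurry₃ B.ω)) hx hy hz
  have h2 := convMul_apply_tmul₃ (toConv (uncurry₃ B.ω)) (B.formAssocLeft φ) hx hy hz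
  simp only [uncurry₃_tmul, formAssocRight_tmul, formAssocLeft_tmul] at h1 h2
  simp only [map_sum, map_smul, smul_eq_mul] at h
  refine h1.trans (Eq.trans ?_ (h.trans h2.symm))
  simp only [mul_comm]

theorem ωInv_mul_formAssocRight (φ : H →ₗ[k] k) :
    toConv (uncurry₃ B.ωInv) * B.formAssocRight φ =
      B.formAssocLeft φ * toConv (uncurry₃ B.ωInv) := by
  calc _ = toConv (uncurry₃ B.ωInv) * (B.formAssocRight φ * toConv (uncurry₃ B.ω)) *
        toConv (uncurry₃ B.ωInv) := by
        rw [mul_assoc, mul_assoc, B.ω_mul_ωInv, _root_.mul_one]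
    _ = _ := by
        rw [formAssocRight_mul_ω, ← mul_assoc, B.ωInv_mul_ω, _root_.one_mul]

section Comatrix

variable {n : ℕ} {c : Fin n → Fin n → H} {S : H →ₗ[k] H} {b : Fin n → H}

theorem IsPreantipode.sum_rTensor (hS : B.IsPreantipode S)
    (hc : ∀ i j, Coalgebra.comul (R := k) (c i j) = ∑ l, c i l ⊗ₜ[k] c l j) (i t : Fin n) :
    ∑ s, LinearMap.rTensor H (B.mul.flip (c s t)) (Coalgebra.comul (R := k) (S (c i s))) =
      B.one ⊗ₜ[k] S (c i t) := by
  choose m σ1 σ2 hσ using fun s => exists_fin_sum_tmul (Coalgebra.comul (R := k) (S (c i s)))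
  rw [← hS.1 _ _ _ _ _ _ _ (hc i t) hσ]
  simp [hσ]

theorem IsPreantipode.sum_lTensor (hS : B.IsPreantipode S)
    (hc : ∀ i j, Coalgebra.comul (R := k) (c i j) = ∑ l, c i l ⊗ₜ[k] c l j) (m s : Fin n) :
    ∑ i, LinearMap.lTensor H (B.mul (c m i)) (Coalgebra.comul (R := k) (S (c i s))) =
      S (c m s) ⊗ₜ[k] B.one := by
  choose m σ1 σ2 hσ using fun i => exists_fin_sum_tmul (Coalgebra.comul (R := k) (S (c i s)))
  rw [← hS.2.1 _ _ _ _ _ _ _ (hc _ s) hσ]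
  simp [hσ]

theorem IsPreantipode.sum_ω (hS : B.IsPreantipode S)
    (hc : ∀ i j, Coalgebra.comul (R := k) (c i j) = ∑ l, c i l ⊗ₜ[k] c l j) (m r : Fin n) :
    ∑ i, ∑ t, B.ω (c m i) (S (c i t)) (c t r) = Coalgebra.counit (R := k) (c m r) :=
  hS.2.2 _ _ _ _ _ _ _ (hc m r) fun i => hc i r

/-- Apply the product of two linear forms to an identity
`∑ i, (id ⊗ L i)(∑ u i p ⊗ v i p) = a ⊗ d`. -/
theorem sum_mul_of_sum_lTensor_eq {k H : Type*} [Field k] [AddCommGroup H] [Module k H]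
    {α : Type*} [Fintype α] {N : α → ℕ} {L : α → H →ₗ[k] H}
    {T : α → H ⊗[k] H} {u v : ∀ i, Fin (N i) → H} {a d : H}
    (h : ∑ i, LinearMap.lTensor H (L i) (T i) = a ⊗ₜ d)
    (hT : ∀ i, T i = ∑ p, u i p ⊗ₜ[k] v i p) (F G : H →ₗ[k] k) :
    ∑ i, ∑ p, F (u i p) * G (L i (v i p)) = F a * G d := by
  have := congrArg (TensorProduct.lift ((LinearMap.mul k k).compl₁₂ F G)) h
  simpa [hT] using this

/-- Apply the product of two linear forms to an identity
`∑ i, (L i ⊗ id)(∑ u i p ⊗ v i p) = a ⊗ d`. -/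
theorem sum_mul_of_sum_rTensor_eq {k H : Type*} [Field k] [AddCommGroup H] [Module k H]
    {α : Type*} [Fintype α] {N : α → ℕ} {L : α → H →ₗ[k] H}
    {T : α → H ⊗[k] H} {u v : ∀ i, Fin (N i) → H} {a d : H}
    (h : ∑ i, LinearMap.rTensor H (L i) (T i) = a ⊗ₜ d)
    (hT : ∀ i, T i = ∑ p, u i p ⊗ₜ[k] v i p) (F G : H →ₗ[k] k) :
    ∑ i, ∑ p, F (L i (u i p)) * G (v i p) = F a * G d := by
  have := congrArg (TensorProduct.lift ((LinearMap.mul k k).compl₁₂ F G)) h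
  simpa [hT] using this

theorem IsPreantipode.sum_ωInv (hS : B.IsPreantipode S)
    (hc : ∀ i j, Coalgebra.comul (R := k) (c i j) = ∑ l, c i l ⊗ₜ[k] c l j)
    (hε : ∀ i j, Coalgebra.counit (R := k) (c i j) = if i = j then 1 else 0)
    (hb : ∀ l, ∑ i, LinearMap.lTensor H (B.mul (c l i)) (Coalgebra.comul (R := k) (b i)) =
      b l ⊗ₜ[k] B.one) (l : Fin n) :
    ∑ s, ∑ r, B.ωInv (S (c l s)) (c s r) (b r) = Coalgebra.counit (R := k) (b l) := by
  choose N σ1 σ2 hσ using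
    fun i s => exists_fin_sum_tmul (Coalgebra.comul (R := k) (S (c i s)))
  choose Q b1 b2 hb12 using fun r => exists_fin_sum_tmul (Coalgebra.comul (R := k) (b r))
  let Φ := formLast B.ωInv * B.formMulRight
  have hP1 (i t) := sum_mul_of_sum_rTensor_eq (hS.sum_rTensor B hc i t) (hσ i)
  have hP2 (m s) := sum_mul_of_sum_lTensor_eq (hS.sum_lTensor B hc m s) (fun i => hσ i s)
  have hB (t) := sum_mul_of_sum_lTensor_eq (hb t) hb12
  have hX (i s r) := congrArg
    (fun f => f.ofConv (c l i ⊗ₜ (S (c i s) ⊗ₜ (c s r ⊗ₜ b r)))) B.formLast_ωInv_mul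
  have hsum := Finset.sum_congr (rfl : (Finset.univ : Finset (Fin n)) = _) fun s _ =>
    Finset.sum_congr (rfl : (Finset.univ : Finset (Fin n)) = _) fun r _ =>
      Finset.sum_congr (rfl : (Finset.univ : Finset (Fin n)) = _) fun i _ => hX i s r
  have hright : ∑ s, ∑ r, ∑ i, (B.formMulMiddle * formFirst B.ω).ofConv
      (c l i ⊗ₜ (S (c i s) ⊗ₜ (c s r ⊗ₜ b r))) = Coalgebra.counit (R := k) (b l) := by
    calc _ = ∑ s, ∑ r, ∑ i, ∑ m, ∑ p, ∑ t, B.ω (c l m) (B.mul (σ1 i s p) (c s t)) (b r) *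
          B.ω (c m i) (σ2 i s p) (c t r) := by
            refine Finset.sum_congr rfl fun s _ => Finset.sum_congr rfl fun r _ =>
              Finset.sum_congr rfl fun i _ => ?_
            exact B.formMulMiddle_mul_formFirst_apply (hc l i) (hσ i s) (hc s r)
      _ = ∑ r, ∑ i, ∑ m, ∑ t, ∑ s, ∑ p, B.ω (c l m) (B.mul (σ1 i s p) (c s t)) (b r) *
          B.ω (c m i) (σ2 i s p) (c t r) := by
            rw [Finset.sum_comm]; refine Finset.sum_congr rfl fun r _ => ?_
            rw [Finset.sum_comm]; refine Finset.sum_congr rfl fun i _ => ?_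
            rw [Finset.sum_comm]; refine Finset.sum_congr rfl fun m _ => ?_
            rw [Finset.sum_congr rfl fun s _ => Finset.sum_comm, Finset.sum_comm]
      _ = ∑ r, ∑ i, ∑ m, ∑ t, B.ω (c l m) B.one (b r) *
          B.ω (c m i) (S (c i t)) (c t r) := by
            refine Finset.sum_congr rfl fun r _ => Finset.sum_congr rfl fun i _ =>
              Finset.sum_congr rfl fun m _ => Finset.sum_congr rfl fun t _ => ?_
            exact hP1 i t ((B.ω (c l m)).flip (b r)) ((B.ω (c m i)).flip (c t r))
      _ = ∑ r, ∑ m, B.ω (c l m) B.one (b r) * Coalgebra.counit (R := k) (c m r) := by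
            refine Finset.sum_congr rfl fun r _ => ?_
            rw [Finset.sum_comm]; refine Finset.sum_congr rfl fun m _ => ?_
            simp only [← Finset.mul_sum, hS.sum_ω B hc]
      _ = _ := by simp [B.ω_one, hε]
  have hleft : ∑ s, ∑ r, ∑ i, (Φ * B.formMulLeft).ofConv
      (c l i ⊗ₜ (S (c i s) ⊗ₜ (c s r ⊗ₜ b r))) =
      ∑ s, ∑ r, ∑ m, Φ.ofConv (c l m ⊗ₜ (S (c m s) ⊗ₜ (c s r ⊗ₜ b r))) := by
    refine Finset.sum_congr rfl fun s _ => ?_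
    calc _ = ∑ r, ∑ i, ∑ m, ∑ p, ∑ t, ∑ q, Φ.ofConv (c l m ⊗ₜ (σ1 i s p ⊗ₜ (c s t ⊗ₜ b1 r q))) *
          B.ω (B.mul (c m i) (σ2 i s p)) (c t r) (b2 r q) := by
            refine Finset.sum_congr rfl fun r _ => Finset.sum_congr rfl fun i _ => ?_
            refine (convMul_apply_tmul₄ _ _ (hc l i) (hσ i s) (hc s r) (hb12 r)).trans ?_
            simp only [formMulLeft_tmul]
      _ = ∑ r, ∑ m, ∑ t, ∑ q, ∑ i, ∑ p, Φ.ofConv (c l m ⊗ₜ (σ1 i s p ⊗ₜ (c s t ⊗ₜ b1 r q))) *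
          B.ω (B.mul (c m i) (σ2 i s p)) (c t r) (b2 r q) := by
            refine Finset.sum_congr rfl fun r _ => ?_
            rw [Finset.sum_comm]; refine Finset.sum_congr rfl fun m _ => ?_
            rw [Finset.sum_congr rfl fun i _ => Finset.sum_comm, Finset.sum_comm]
            refine Finset.sum_congr rfl fun t _ => ?_
            rw [Finset.sum_congr rfl fun i _ => Finset.sum_comm, Finset.sum_comm]
      _ = ∑ r, ∑ m, ∑ t, ∑ q, Φ.ofConv (c l m ⊗ₜ (S (c m s) ⊗ₜ (c s t ⊗ₜ b1 r q))) *
          B.ω B.one (c t r) (b2 r q) := by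
            refine Finset.sum_congr rfl fun r _ => Finset.sum_congr rfl fun m _ =>
              Finset.sum_congr rfl fun t _ => Finset.sum_congr rfl fun q _ => ?_
            exact hP2 m s (Φ.ofConv ∘ₗ TensorProduct.mk k H _ (c l m) ∘ₗ
                (TensorProduct.mk k H _).flip (c s t ⊗ₜ b1 r q))
              ((B.ω.flip (c t r)).flip (b2 r q))
      _ = _ := by
            refine Finset.sum_congr rfl fun r _ => Finset.sum_congr rfl fun m _ => ?_
            have := sum_mul_counit_of_comul_eq (Φ.ofConv ∘ₗ TensorProduct.mk k H _ (c l m) ∘ₗ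
                TensorProduct.mk k H _ (S (c m s)) ∘ₗ TensorProduct.mk k H _ (c s r)) (hb12 r)
            simp only [LinearMap.comp_apply, TensorProduct.mk_apply] at this
            rw [← this]
            simp [B.ω_one_left, hε]
  have hΦ : ∑ s, ∑ r, ∑ m, Φ.ofConv (c l m ⊗ₜ (S (c m s) ⊗ₜ (c s r ⊗ₜ b r))) =
      ∑ s, ∑ r, B.ωInv (S (c l s)) (c s r) (b r) := by
    refine Finset.sum_congr rfl fun s _ => ?_
    calc _ = ∑ r, ∑ m, ∑ p, ∑ t, ∑ q, B.ωInv (σ1 m s p) (c s t) (b1 r q) *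
          B.ω (c l m) (σ2 m s p) (B.mul (c t r) (b2 r q)) := by
            refine Finset.sum_congr rfl fun r _ => Finset.sum_congr rfl fun m _ => ?_
            refine (formLast_mul_apply _ _ (hσ m s) (hc s r) (hb12 r)).trans ?_
            simp only [formMulRight_tmul]
      _ = ∑ t, ∑ m, ∑ p, ∑ r, ∑ q, B.ωInv (σ1 m s p) (c s t) (b1 r q) *
          B.ω (c l m) (σ2 m s p) (B.mul (c t r) (b2 r q)) := by
            rw [Finset.sum_comm, eq_comm, Finset.sum_comm]
            refine Finset.sum_congr rfl fun m _ => ?_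
            rw [Finset.sum_comm, eq_comm, Finset.sum_comm]
            exact Finset.sum_congr rfl fun p _ => Finset.sum_comm
      _ = ∑ t, ∑ m, ∑ p, B.ωInv (σ1 m s p) (c s t) (b t) *
          B.ω (c l m) (σ2 m s p) B.one := by
            refine Finset.sum_congr rfl fun t _ => Finset.sum_congr rfl fun m _ =>
              Finset.sum_congr rfl fun p _ => ?_
            exact hB t (B.ωInv (σ1 m s p) (c s t)) (B.ω (c l m) (σ2 m s p))
      _ = _ := by
            refine Finset.sum_congr rfl fun t _ => ?_
            have := sum_mul_counit_of_comul_eq ((B.ωInv.flip (c s t)).flip (b t)) (hσ l s)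
            simp only [LinearMap.flip_apply] at this
            rw [← this, Finset.sum_eq_single l]
            · simp [B.ω_one_right, hε]
            · intro m _ hm
              simp [B.ω_one_right, hε, hm.symm]
            · simp
  rw [← hΦ, ← hleft, ← hright]
  exact hsum

theorem IsPreantipode.sum_ωInv_smul (hS : B.IsPreantipode S)
    (hc : ∀ i j, Coalgebra.comul (R := k) (c i j) = ∑ l, c i l ⊗ₜ[k] c l j)
    (hε : ∀ i j, Coalgebra.counit (R := k) (c i j) = if i = j then 1 else 0)
    (hb : ∀ l, ∑ i, LinearMap.lTensor H (B.mul (c l i)) (Coalgebra.comul (R := k) (b i)) =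
      b l ⊗ₜ[k] B.one) (i : Fin n) :
    ∑ s, ∑ r, TensorProduct.lid k H (LinearMap.rTensor H ((B.ωInv.flip (c s r)).flip (b r))
      (Coalgebra.comul (R := k) (S (c i s)))) = b i := by
  choose N σ1 σ2 hσ using
    fun s => exists_fin_sum_tmul (Coalgebra.comul (R := k) (S (c i s)))
  choose Q b1 b2 hb12 using fun r => exists_fin_sum_tmul (Coalgebra.comul (R := k) (b r))
  rw [← sub_eq_zero, ← Module.forall_dual_apply_eq_zero_iff k]
  intro φ
  rw [map_sub, sub_eq_zero]
  have hP1 (t) := sum_mul_of_sum_rTensor_eq (hS.sum_rTensor B hc i t) hσ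
  have hB (t) := sum_mul_of_sum_lTensor_eq (hb t) hb12
  let θ : H →ₗ[k] H := (TensorProduct.lid k H).toLinearMap ∘ₗ LinearMap.rTensor H φ ∘ₗ
    Coalgebra.comul (R := k) (A := H)
  have hθ (a : H) : Coalgebra.comul (R := k) (θ a) =
      LinearMap.rTensor H θ (Coalgebra.comul (R := k) a) := by
    have h1 (t : H ⊗[k] H) : Coalgebra.comul (R := k) (TensorProduct.lid k H
        (LinearMap.rTensor H φ t)) = TensorProduct.lid k _ (LinearMap.rTensor _ φ
          (LinearMap.lTensor H (Coalgebra.comul (R := k)) t)) := by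
      induction t with
      | zero => simp
      | tmul x y => simp
      | add x y hx hy => simp only [map_add, hx, hy]
    have h2 (t : (H ⊗[k] H) ⊗[k] H) : TensorProduct.lid k _ (LinearMap.rTensor _ φ
        (TensorProduct.assoc k H H H t)) = LinearMap.rTensor H
          ((TensorProduct.lid k H).toLinearMap ∘ₗ LinearMap.rTensor H φ) t := by
      induction t with
      | zero => simp
      | tmul x y =>
        induction x with
        | zero => simp
        | tmul x z => simp [TensorProduct.smul_tmul']
        | add x z hx hz => simp only [map_add, hx, hz, TensorProduct.add_tmul]
      | add x y hx hy => simp only [map_add, hx, hy]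
    calc _ = _ := h1 _
      _ = _ := by
        rw [← Coalgebra.coassoc_apply, h2, ← LinearMap.comp_apply, ← LinearMap.rTensor_comp]
        rfl
  have hbθ (l) : ∑ i, LinearMap.lTensor H (B.mul (c l i)) (Coalgebra.comul (R := k) (θ (b i))) =
      θ (b l) ⊗ₜ[k] B.one := by
    have := congrArg (LinearMap.rTensor H θ) (hb l)
    rw [LinearMap.rTensor_tmul, map_sum] at this
    rw [← this]
    refine Finset.sum_congr rfl fun i _ => ?_
    rw [hθ]
    exact LinearMap.congr_fun ((LinearMap.lTensor_comp_rTensor _ _ _).trans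
      (LinearMap.rTensor_comp_lTensor _ _ _).symm) _
  have hθb (r) : θ (b r) = ∑ q, φ (b1 r q) • b2 r q := by
    simp [θ, hb12]
  have hεθ : Coalgebra.counit (R := k) (θ (b i)) = φ (b i) := by
    rw [hθb, map_sum, ← sum_mul_counit_of_comul_eq φ (hb12 i)]
    simp
  rw [← hεθ, ← hS.sum_ωInv B hc hε hbθ i]
  have hX (s r) := congrArg (fun f => f.ofConv (S (c i s) ⊗ₜ (c s r ⊗ₜ b r)))
    (B.ωInv_mul_formAssocRight φ)
  have hsum := Finset.sum_congr (rfl : (Finset.univ : Finset (Fin n)) = _) fun s _ =>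
    Finset.sum_congr (rfl : (Finset.univ : Finset (Fin n)) = _) fun r _ => hX s r
  refine Eq.trans (Eq.symm ?_) (hsum.trans ?_)
  · simp only [map_sum, hσ, LinearMap.rTensor_tmul, TensorProduct.lid_tmul, map_smul, smul_eq_mul,
      LinearMap.flip_apply]
    refine Finset.sum_congr rfl fun s _ => ?_
    calc _ = ∑ r, ∑ p, ∑ t, ∑ q, B.ωInv (σ1 s p) (c s t) (b1 r q) *
          φ (B.mul (σ2 s p) (B.mul (c t r) (b2 r q))) := by
            refine Finset.sum_congr rfl fun r _ => ?_
            refine (convMul_apply_tmul₃ _ _ (hσ s) (hc s r) (hb12 r)).trans ?_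
            simp only [uncurry₃_tmul, formAssocRight_tmul]
      _ = ∑ t, ∑ p, ∑ r, ∑ q, B.ωInv (σ1 s p) (c s t) (b1 r q) *
          φ (B.mul (σ2 s p) (B.mul (c t r) (b2 r q))) := by
            rw [Finset.sum_comm, eq_comm, Finset.sum_comm]
            exact Finset.sum_congr rfl fun p _ => Finset.sum_comm
      _ = _ := by
            refine Finset.sum_congr rfl fun t _ => Finset.sum_congr rfl fun p _ => ?_
            refine (hB t (B.ωInv (σ1 s p) (c s t)) (φ ∘ₗ B.mul (σ2 s p))).trans ?_
            simp [B.mul_one]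
  · calc _ = ∑ s, ∑ r, ∑ p, ∑ t, ∑ q, φ (B.mul (B.mul (σ1 s p) (c s t)) (b1 r q)) *
          B.ωInv (σ2 s p) (c t r) (b2 r q) := by
            refine Finset.sum_congr rfl fun s _ => Finset.sum_congr rfl fun r _ => ?_
            refine (convMul_apply_tmul₃ _ _ (hσ s) (hc s r) (hb12 r)).trans ?_
            simp only [uncurry₃_tmul, formAssocLeft_tmul]
      _ = ∑ t, ∑ r, ∑ q, ∑ s, ∑ p, φ (B.mul (B.mul (σ1 s p) (c s t)) (b1 r q)) *
          B.ωInv (σ2 s p) (c t r) (b2 r q) := by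
            rw [Finset.sum_comm, eq_comm, Finset.sum_comm, eq_comm]
            refine Finset.sum_congr rfl fun r _ => ?_
            rw [Finset.sum_congr rfl fun s _ => Finset.sum_comm, Finset.sum_comm]
            refine Finset.sum_congr rfl fun t _ => ?_
            rw [Finset.sum_congr rfl fun s _ => Finset.sum_comm, Finset.sum_comm]
      _ = ∑ t, ∑ r, ∑ q, φ (b1 r q) * B.ωInv (S (c i t)) (c t r) (b2 r q) := by
            refine Finset.sum_congr rfl fun t _ => Finset.sum_congr rfl fun r _ =>
              Finset.sum_congr rfl fun q _ => ?_
            refine (hP1 t (φ ∘ₗ B.mul.flip (b1 r q)) ((B.ωInv.flip (c t r)).flip (b2 r q))).trans ?_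
            simp [B.one_mul]
      _ = _ := by
            refine Finset.sum_congr rfl fun t _ => Finset.sum_congr rfl fun r _ => ?_
            simp [hθb]

end Comatrix

end CoquasiBialgebra

end ConvolutionIdentities
section AmbientCoactions

theorem mem_range_lTensor_subtype_eqLocus {k M N P : Type*} [Field k] [AddCommMonoid M]
    [Module k M] [AddCommMonoid N] [Module k N] [AddCommMonoid P] [Module k P]
    {f g : N →ₗ[k] P} {t : M ⊗[k] N}
    (ht : LinearMap.lTensor M f t = LinearMap.lTensor M g t) :
    t ∈ LinearMap.range (LinearMap.lTensor M (LinearMap.eqLocus f g).subtype) := by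
  let _ : AddCommGroup M := Module.addCommMonoidToAddCommGroup k
  let _ : AddCommGroup N := Module.addCommMonoidToAddCommGroup k
  let _ : AddCommGroup P := Module.addCommMonoidToAddCommGroup k
  exact (SetLike.ext_iff.mp (Module.Flat.eqLocus_lTensor_eq k M f g) t).mp ht

variable {V : Type*} [AddCommGroup V] [Module k V]

theorem ambientLeftCoaction_tmul (f : V →ₗ[k] k) (b : H) :
    ambientLeftCoaction (k := k) (f ⊗ₜ[k] b) =
      LinearMap.lTensor H (TensorProduct.mk k (V →ₗ[k] k) H f) (Coalgebra.comul (R := k) b) := by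
  simp only [ambientLeftCoaction, LinearMap.comp_apply, LinearMap.lTensor_tmul]
  induction Coalgebra.comul (R := k) b with
  | zero => simp
  | tmul x y => simp
  | add x y hx hy => simp only [TensorProduct.tmul_add, map_add, hx, hy]

theorem ambientRightCoaction_tmul (B : CoquasiBialgebra k H)
    (ρdual : (V →ₗ[k] k) →ₗ[k] (V →ₗ[k] k) ⊗[k] H) {f : V →ₗ[k] k} (b : H)
    {α : Type*} [Fintype α] {f0 : α → V →ₗ[k] k} {f1 : α → H}
    (hf : ρdual f = ∑ t, f0 t ⊗ₜ[k] f1 t) :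
    ambientRightCoaction B ρdual (f ⊗ₜ[k] b) =
      ∑ t, TensorProduct.map (TensorProduct.mk k (V →ₗ[k] k) H (f0 t)) (B.mul (f1 t))
        (Coalgebra.comul (R := k) b) := by
  simp only [ambientRightCoaction, LinearMap.comp_apply, LinearMap.lTensor_tmul,
    LinearMap.rTensor_tmul, hf]
  induction Coalgebra.comul (R := k) b with
  | zero => simp
  | tmul x y => simp [TensorProduct.sum_tmul]
  | add x y hx hy => simp only [TensorProduct.tmul_add, map_add, hx, hy, Finset.sum_add_distrib]

theorem ambientLeftCoaction_coassoc (x : (V →ₗ[k] k) ⊗[k] H) :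
    LinearMap.rTensor _ (Coalgebra.comul (R := k) (A := H)) (ambientLeftCoaction (k := k) x) =
      (TensorProduct.assoc k H H _).symm
        (LinearMap.lTensor H ambientLeftCoaction (ambientLeftCoaction (k := k) x)) := by
  induction x with
  | zero => simp
  | add x y hx hy => simp only [map_add, hx, hy]
  | tmul f b =>
    have h1 (t : H ⊗[k] H) : LinearMap.lTensor H (ambientLeftCoaction (k := k))
        (LinearMap.lTensor H (TensorProduct.mk k (V →ₗ[k] k) H f) t) =
        LinearMap.lTensor H (LinearMap.lTensor H (TensorProduct.mk k (V →ₗ[k] k) H f))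
          (LinearMap.lTensor H (Coalgebra.comul (R := k)) t) := by
      induction t with
      | zero => simp
      | add x y hx hy => simp only [map_add, hx, hy]
      | tmul x y => simp [ambientLeftCoaction_tmul]
    have h2 (t : (H ⊗[k] H) ⊗[k] H) : (TensorProduct.assoc k H H _).symm (LinearMap.lTensor H
        (LinearMap.lTensor H (TensorProduct.mk k (V →ₗ[k] k) H f))
          (TensorProduct.assoc k H H H t)) =
        LinearMap.lTensor (H ⊗[k] H) (TensorProduct.mk k (V →ₗ[k] k) H f) t := by
      induction t with
      | zero => simp
      | add x y hx hy => simp only [map_add, hx, hy]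
      | tmul x y =>
        induction x with
        | zero => simp
        | add x z hx hz => simp only [map_add, hx, hz, TensorProduct.add_tmul]
        | tmul x z => simp
    rw [ambientLeftCoaction_tmul, h1, ← Coalgebra.coassoc_apply, h2]
    exact LinearMap.congr_fun ((LinearMap.rTensor_comp_lTensor _ _ _).trans
      (LinearMap.lTensor_comp_rTensor _ _ _).symm) _

theorem lid_rTensor_counit_ambientLeftCoaction (x : (V →ₗ[k] k) ⊗[k] H) :
    TensorProduct.lid k _ (LinearMap.rTensor _ (Coalgebra.counit (R := k) (A := H))
      (ambientLeftCoaction (k := k) x)) = x := by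
  induction x with
  | zero => simp
  | add x y hx hy => simp only [map_add, hx, hy]
  | tmul f b =>
    obtain ⟨n, b1, b2, hb⟩ := exists_fin_sum_tmul (Coalgebra.comul (R := k) b)
    rw [ambientLeftCoaction_tmul, ← sum_counit_smul_of_comul_eq hb, sum_counit_smul_of_comul_eq hb,
      hb]
    conv_rhs => rw [← sum_counit_smul_of_comul_eq hb]
    simp [TensorProduct.tmul_sum]

theorem lTensor_ambientRightCoaction_ambientLeftCoaction (B : CoquasiBialgebra k H)
    (ρdual : (V →ₗ[k] k) →ₗ[k] (V →ₗ[k] k) ⊗[k] H) (x : (V →ₗ[k] k) ⊗[k] H) :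
    LinearMap.lTensor H (ambientRightCoaction B ρdual) (ambientLeftCoaction (k := k) x) =
      TensorProduct.assoc k _ _ _ (LinearMap.rTensor H ambientLeftCoaction
        (ambientRightCoaction B ρdual x)) := by
  induction x with
  | zero => simp
  | add x y hx hy => simp only [map_add, hx, hy]
  | tmul f b =>
    obtain ⟨n, f0, f1, hf⟩ := exists_fin_sum_tmul (ρdual f)
    have h1 (t : H ⊗[k] H) : LinearMap.lTensor H (ambientRightCoaction B ρdual)
        (LinearMap.lTensor H (TensorProduct.mk k (V →ₗ[k] k) H f) t) =
        ∑ i, LinearMap.lTensor H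
          (TensorProduct.map (TensorProduct.mk k (V →ₗ[k] k) H (f0 i)) (B.mul (f1 i)))
          (LinearMap.lTensor H (Coalgebra.comul (R := k)) t) := by
      induction t with
      | zero => simp
      | add x y hx hy => simp only [map_add, hx, hy, Finset.sum_add_distrib]
      | tmul x y =>
        simp [ambientRightCoaction_tmul B ρdual _ hf, TensorProduct.tmul_sum]
    have h2 (i) (t : H ⊗[k] H) : LinearMap.rTensor H (ambientLeftCoaction (k := k))
        (TensorProduct.map (TensorProduct.mk k (V →ₗ[k] k) H (f0 i)) (B.mul (f1 i)) t) =
        TensorProduct.map (LinearMap.lTensor H (TensorProduct.mk k (V →ₗ[k] k) H (f0 i)))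
          (B.mul (f1 i)) (LinearMap.rTensor H (Coalgebra.comul (R := k)) t) := by
      induction t with
      | zero => simp
      | add x y hx hy => simp only [map_add, hx, hy]
      | tmul x y => simp [ambientLeftCoaction_tmul]
    have h3 (i) (t : (H ⊗[k] H) ⊗[k] H) : LinearMap.lTensor H
          (TensorProduct.map (TensorProduct.mk k (V →ₗ[k] k) H (f0 i)) (B.mul (f1 i)))
          (TensorProduct.assoc k H H H t) =
        TensorProduct.assoc k _ _ _ (TensorProduct.map (LinearMap.lTensor H
          (TensorProduct.mk k (V →ₗ[k] k) H (f0 i))) (B.mul (f1 i)) t) := by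
      induction t with
      | zero => simp
      | add x y hx hy => simp only [map_add, hx, hy]
      | tmul x y =>
        induction x with
        | zero => simp
        | add x z hx hz => simp only [map_add, hx, hz, TensorProduct.add_tmul]
        | tmul x z => simp
    rw [ambientLeftCoaction_tmul, h1, ambientRightCoaction_tmul B ρdual b hf]
    simp only [map_sum, h2, ← h3, Coalgebra.coassoc_apply]

theorem mem_coinvariants_iff (B : CoquasiBialgebra k H)
    (ρdual : (V →ₗ[k] k) →ₗ[k] (V →ₗ[k] k) ⊗[k] H) (x : (V →ₗ[k] k) ⊗[k] H) :
    x ∈ coinvariants B ρdual ↔ ambientRightCoaction B ρdual x = x ⊗ₜ[k] B.one :=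
  Iff.rfl

theorem ambientLeftCoaction_mem_range (B : CoquasiBialgebra k H)
    (ρdual : (V →ₗ[k] k) →ₗ[k] (V →ₗ[k] k) ⊗[k] H) {x : (V →ₗ[k] k) ⊗[k] H}
    (hx : x ∈ coinvariants B ρdual) :
    ambientLeftCoaction (k := k) x ∈
      LinearMap.range (LinearMap.lTensor H (coinvariants B ρdual).subtype) := by
  refine mem_range_lTensor_subtype_eqLocus ?_
  have h1 (t : H ⊗[k] ((V →ₗ[k] k) ⊗[k] H)) : TensorProduct.assoc k _ _ _ (t ⊗ₜ B.one) =
      LinearMap.lTensor H ((TensorProduct.mk k ((V →ₗ[k] k) ⊗[k] H) H).flip B.one) t := by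
    induction t with
    | zero => simp
    | add x y hx hy => simp only [map_add, TensorProduct.add_tmul, hx, hy]
    | tmul x y => simp
  refine (lTensor_ambientRightCoaction_ambientLeftCoaction B ρdual x).trans ?_
  rw [(mem_coinvariants_iff B ρdual x).mp hx, LinearMap.rTensor_tmul]
  exact h1 _

theorem exists_coinvariants_coaction (B : CoquasiBialgebra k H)
    (ρdual : (V →ₗ[k] k) →ₗ[k] (V →ₗ[k] k) ⊗[k] H) :
    ∃ ρ' : coinvariants B ρdual →ₗ[k] H ⊗[k] coinvariants B ρdual,
      (∀ x, LinearMap.lTensor H (coinvariants B ρdual).subtype (ρ' x) =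
        ambientLeftCoaction (k := k) (x : (V →ₗ[k] k) ⊗[k] H)) ∧
      (LinearMap.rTensor _ (Coalgebra.comul (R := k) (A := H)) ∘ₗ ρ' =
        (TensorProduct.assoc k H H _).symm.toLinearMap ∘ₗ LinearMap.lTensor H ρ' ∘ₗ ρ') ∧
      ((TensorProduct.lid k _).toLinearMap ∘ₗ
        LinearMap.rTensor _ (Coalgebra.counit (R := k) (A := H)) ∘ₗ ρ' = LinearMap.id) := by
  set W := coinvariants B ρdual
  have hinj (M : Type _) [AddCommGroup M] [Module k M] :
      Function.Injective (LinearMap.lTensor M W.subtype) :=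
    Module.Flat.lTensor_preserves_injective_linearMap _ W.injective_subtype
  let ρ' : W →ₗ[k] H ⊗[k] W :=
    (LinearEquiv.ofInjective (LinearMap.lTensor H W.subtype) (hinj H)).symm.toLinearMap ∘ₗ
      LinearMap.codRestrict _ (ambientLeftCoaction (k := k) ∘ₗ W.subtype)
        fun x => ambientLeftCoaction_mem_range B ρdual x.2
  have hρ' (x) : LinearMap.lTensor H W.subtype (ρ' x) =
      ambientLeftCoaction (k := k) (x : (V →ₗ[k] k) ⊗[k] H) := by
    have := LinearEquiv.apply_symm_apply
      (LinearEquiv.ofInjective (LinearMap.lTensor H W.subtype) (hinj H))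
      (LinearMap.codRestrict _ (ambientLeftCoaction (k := k) ∘ₗ W.subtype)
        (fun x => ambientLeftCoaction_mem_range B ρdual x.2) x)
    exact congrArg Subtype.val this
  refine ⟨ρ', hρ', ?_, ?_⟩
  · ext x
    refine hinj (H ⊗[k] H) ?_
    have h1 (t : H ⊗[k] W) : LinearMap.lTensor (H ⊗[k] H) W.subtype
        ((TensorProduct.assoc k H H _).symm (LinearMap.lTensor H ρ' t)) =
        (TensorProduct.assoc k H H _).symm (LinearMap.lTensor H (ambientLeftCoaction (k := k))
          (LinearMap.lTensor H W.subtype t)) := by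
      induction t with
      | zero => simp
      | add x y hx hy => simp only [map_add, hx, hy]
      | tmul a y =>
        simp only [LinearMap.lTensor_tmul, Submodule.subtype_apply, ← hρ']
        induction ρ' y with
        | zero => simp
        | add x y hx hy => simp only [map_add, TensorProduct.tmul_add, hx, hy]
        | tmul x y => simp
    simp only [LinearMap.comp_apply, LinearEquiv.coe_coe, h1, hρ', ← ambientLeftCoaction_coassoc]
    rw [← hρ']
    exact LinearMap.congr_fun ((LinearMap.lTensor_comp_rTensor _ _ _).trans
      (LinearMap.rTensor_comp_lTensor _ _ _).symm) _
  · ext x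
    have h1 (t : H ⊗[k] W) : ((TensorProduct.lid k W
        (LinearMap.rTensor W (Coalgebra.counit (R := k) (A := H)) t) : W) : _ ⊗[k] H) =
        TensorProduct.lid k _ (LinearMap.rTensor _ (Coalgebra.counit (R := k) (A := H))
          (LinearMap.lTensor H W.subtype t)) := by
      induction t with
      | zero => simp
      | add x y hx hy => simp only [map_add, Submodule.coe_add, hx, hy]
      | tmul a y => simp
    simp only [LinearMap.comp_apply, LinearEquiv.coe_coe, h1, hρ',
      lid_rTensor_counit_ambientLeftCoaction, LinearMap.id_apply]

end AmbientCoactions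

section Coordinates

variable {V : Type*} [AddCommGroup V] [Module k V] {n : ℕ} (β : Module.Basis (Fin n) k V)

theorem sum_rid_tmul_basis {M : Type*} [AddCommMonoid M] [Module k M] (t : M ⊗[k] V) :
    ∑ j, TensorProduct.rid k M (LinearMap.lTensor M (β.coord j) t) ⊗ₜ[k] β j = t := by
  induction t with
  | zero => simp
  | add x y hx hy =>
    simp only [map_add, TensorProduct.add_tmul, Finset.sum_add_distrib, hx, hy]
  | tmul a v =>
    simp only [LinearMap.lTensor_tmul, TensorProduct.rid_tmul, TensorProduct.smul_tmul]
    rw [← TensorProduct.tmul_sum]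
    simp [β.sum_repr]

theorem eq_of_sum_tmul_basis_eq {M : Type*} [AddCommMonoid M] [Module k M] {a b : Fin n → M}
    (h : ∑ j, a j ⊗ₜ[k] β j = ∑ j, b j ⊗ₜ[k] β j) (l : Fin n) : a l = b l := by
  have h1 (a : Fin n → M) : TensorProduct.rid k M (LinearMap.lTensor M (β.coord l)
      (∑ j, a j ⊗ₜ[k] β j)) = a l := by
    simp [Finsupp.single_apply, eq_comm]
  rw [← h1 a, h, h1 b]

theorem sum_coord_tmul_lid {M : Type*} [AddCommMonoid M] [Module k M]
    (x : (V →ₗ[k] k) ⊗[k] M) :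
    ∑ i, β.coord i ⊗ₜ[k] TensorProduct.lid k M
      (LinearMap.rTensor M (LinearMap.applyₗ (β i)) x) = x := by
  induction x with
  | zero => simp
  | add x y hx hy =>
    simp only [map_add, TensorProduct.tmul_add, Finset.sum_add_distrib, hx, hy]
  | tmul f b =>
    have hf : ∑ i, f (β i) • β.coord i = f := β.sum_dual_apply_smul_coord f
    simp only [LinearMap.rTensor_tmul, TensorProduct.lid_tmul, ← TensorProduct.smul_tmul,
      LinearMap.applyₗ_apply_apply]
    rw [← TensorProduct.sum_tmul, hf]

/-- The matrix coefficients `c i j` of a left coaction, with `ρ (β i) = ∑ j, c i j ⊗ β j`. -/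
noncomputable def coactionMatrix (ρ : V →ₗ[k] H ⊗[k] V) (i j : Fin n) : H :=
  TensorProduct.rid k H (LinearMap.lTensor H (β.coord j) (ρ (β i)))

theorem coaction_basis {k H V : Type*} [Field k] [AddCommGroup H] [Module k H]
    [AddCommGroup V] [Module k V] {n : ℕ} (β : Module.Basis (Fin n) k V)
    (ρ : V →ₗ[k] H ⊗[k] V) (i : Fin n) :
    ρ (β i) = ∑ j, coactionMatrix β ρ i j ⊗ₜ[k] β j :=
  (sum_rid_tmul_basis β _).symm

theorem comul_coactionMatrix {ρ : V →ₗ[k] H ⊗[k] V}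
    (hρ : LinearMap.rTensor V (Coalgebra.comul (R := k) (A := H)) ∘ₗ ρ =
      (TensorProduct.assoc k H H V).symm.toLinearMap ∘ₗ LinearMap.lTensor H ρ ∘ₗ ρ)
    (i j : Fin n) : Coalgebra.comul (R := k) (coactionMatrix β ρ i j) =
      ∑ l, coactionMatrix β ρ i l ⊗ₜ[k] coactionMatrix β ρ l j := by
  refine eq_of_sum_tmul_basis_eq β (a := fun j => Coalgebra.comul (R := k)
    (coactionMatrix β ρ i j)) (b := fun j => ∑ l, coactionMatrix β ρ i l ⊗ₜ[k]
    coactionMatrix β ρ l j) ?_ j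
  have h := LinearMap.congr_fun hρ (β i)
  simp only [LinearMap.comp_apply, coaction_basis, map_sum, LinearMap.rTensor_tmul,
    LinearMap.lTensor_tmul, TensorProduct.tmul_sum, LinearEquiv.coe_coe,
    TensorProduct.assoc_symm_tmul] at h
  rw [h, Finset.sum_comm]
  simp only [TensorProduct.sum_tmul]

theorem counit_coactionMatrix {ρ : V →ₗ[k] H ⊗[k] V}
    (hρ : (TensorProduct.lid k V).toLinearMap ∘ₗ
      LinearMap.rTensor V (Coalgebra.counit (R := k) (A := H)) ∘ₗ ρ = LinearMap.id)
    (i j : Fin n) : Coalgebra.counit (R := k) (coactionMatrix β ρ i j) =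
      if i = j then 1 else 0 := by
  have h := congrArg (β.coord j) (LinearMap.congr_fun hρ (β i))
  simpa [coaction_basis, Finsupp.single_apply] using h

theorem dualCoaction_coord {k H V : Type*} [Field k] [AddCommGroup H] [Module k H]
    [AddCommGroup V] [Module k V] {n : ℕ} (β : Module.Basis (Fin n) k V) {ρ : V →ₗ[k] H ⊗[k] V}
    {ρdual : (V →ₗ[k] k) →ₗ[k] (V →ₗ[k] k) ⊗[k] H}
    (hρdual : ∀ (f : V →ₗ[k] k) (v : V) (n m : ℕ)
      (f0 : Fin n → V →ₗ[k] k) (f1 : Fin n → H) (vm : Fin m → H) (v0 : Fin m → V),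
      ρdual f = ∑ t, f0 t ⊗ₜ[k] f1 t → ρ v = ∑ s, vm s ⊗ₜ[k] v0 s →
      ∑ t, f0 t v • f1 t = ∑ s, f (v0 s) • vm s) (j : Fin n) :
    ρdual (β.coord j) = ∑ i, β.coord i ⊗ₜ[k] coactionMatrix β ρ i j := by
  obtain ⟨m, f0, f1, hf⟩ := exists_fin_sum_tmul (ρdual (β.coord j))
  rw [← sum_coord_tmul_lid β (ρdual (β.coord j))]
  refine Finset.sum_congr rfl fun i _ => ?_
  congr 1
  have h := hρdual _ _ _ _ _ _ _ _ hf (coaction_basis β ρ i)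
  simpa [hf, Finsupp.single_apply] using h

theorem sum_coord_tmul_mem_coinvariants_iff (B : CoquasiBialgebra k H)
    {ρdual : (V →ₗ[k] k) →ₗ[k] (V →ₗ[k] k) ⊗[k] H} {c : Fin n → Fin n → H}
    (hρdual : ∀ j, ρdual (β.coord j) = ∑ i, β.coord i ⊗ₜ[k] c i j) (b : Fin n → H) :
    ∑ i, β.coord i ⊗ₜ[k] b i ∈ coinvariants B ρdual ↔
      ∀ l, ∑ i, LinearMap.lTensor H (B.mul (c l i)) (Coalgebra.comul (R := k) (b i)) =
        b l ⊗ₜ[k] B.one := by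
  have hR : ambientRightCoaction B ρdual (∑ i, β.coord i ⊗ₜ[k] b i) =
      ∑ l, LinearMap.rTensor H (TensorProduct.mk k (V →ₗ[k] k) H (β.coord l))
        (∑ i, LinearMap.lTensor H (B.mul (c l i)) (Coalgebra.comul (R := k) (b i))) := by
    simp only [map_sum, ambientRightCoaction_tmul B ρdual _ (hρdual _)]
    rw [Finset.sum_comm]
    refine Finset.sum_congr rfl fun l _ => Finset.sum_congr rfl fun i _ => ?_
    rw [← LinearMap.rTensor_comp_lTensor, LinearMap.comp_apply]
  have hone : (∑ i, β.coord i ⊗ₜ[k] b i) ⊗ₜ[k] B.one =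
      ∑ l, LinearMap.rTensor H (TensorProduct.mk k (V →ₗ[k] k) H (β.coord l))
        (b l ⊗ₜ[k] B.one) := by
    simp [TensorProduct.sum_tmul]
  have hcoef (l l') (t : H ⊗[k] H) : LinearMap.rTensor H ((TensorProduct.lid k H).toLinearMap ∘ₗ
      LinearMap.rTensor H (LinearMap.applyₗ (β l)))
      (LinearMap.rTensor H (TensorProduct.mk k (V →ₗ[k] k) H (β.coord l')) t) =
        if l = l' then t else 0 := by
    induction t with
    | zero => simp
    | add x y hx hy => simp only [map_add, hx, hy]; split <;> simp
    | tmul x y => by_cases h : l = l' <;> simp [h]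
  rw [mem_coinvariants_iff, hR, hone]
  refine ⟨fun h l => ?_, fun h => Finset.sum_congr rfl fun l _ => by rw [h]⟩
  have := congrArg (LinearMap.rTensor H ((TensorProduct.lid k H).toLinearMap ∘ₗ
      LinearMap.rTensor H (LinearMap.applyₗ (β l)))) h
  simp only [map_sum (LinearMap.rTensor H ((TensorProduct.lid k H).toLinearMap ∘ₗ
      LinearMap.rTensor H (LinearMap.applyₗ (β l)))), hcoef] at this
  simpa using this

theorem sum_dualBasis_eq {ι : Type*} [Fintype ι] {e : ι → V} {e' : ι → V →ₗ[k] k}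
    (hdual : ∀ v : V, ∑ i, e' i v • e i = v) {M : Type*} [AddCommMonoid M] [Module k M]
    (φ : (V →ₗ[k] k) →ₗ[k] M) :
    ∑ i, φ (e' i) ⊗ₜ[k] e i = ∑ j, φ (β.coord j) ⊗ₜ[k] β j := by
  have hcoord (j) : ∑ i, β.coord j (e i) • e' i = β.coord j := by
    ext v
    conv_rhs => rw [← hdual v]
    simp [mul_comm]
  rw [← sum_rid_tmul_basis β (∑ i, φ (e' i) ⊗ₜ[k] e i)]
  refine Finset.sum_congr rfl fun j _ => ?_
  conv_rhs => rw [← hcoord j]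
  simp

end Coordinates

section Duality

variable {V : Type*} [AddCommGroup V] [Module k V]

/-- The map `(a ⊗ v) ⊗ (b ⊗ x) ↦ ev(v ⊗ x) • ab`. -/
noncomputable def mulEv (B : CoquasiBialgebra k H) :
    (H ⊗[k] V) ⊗[k] (H ⊗[k] ((V →ₗ[k] k) ⊗[k] H)) →ₗ[k] H :=
  (TensorProduct.rid k H).toLinearMap ∘ₗ
    TensorProduct.map (TensorProduct.lift B.mul) ambientEv ∘ₗ
    (TensorProduct.tensorTensorTensorComm k H V H ((V →ₗ[k] k) ⊗[k] H)).toLinearMap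

@[simp]
theorem mulEv_tmul (B : CoquasiBialgebra k H) (a : H) (v : V) (b : H)
    (x : (V →ₗ[k] k) ⊗[k] H) :
    mulEv B ((a ⊗ₜ v) ⊗ₜ (b ⊗ₜ x)) = ambientEv (v ⊗ₜ x) • B.mul a b := by
  simp [mulEv]

@[simp]
theorem ambientEv_tmul (v : V) (f : V →ₗ[k] k) (b : H) :
    ambientEv (v ⊗ₜ[k] (f ⊗ₜ[k] b)) = f v * Coalgebra.counit (R := k) b := by
  simp [ambientEv]

theorem mulEv_ambientLeftCoaction_tmul (B : CoquasiBialgebra k H) (a : H) (v : V)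
    (f : V →ₗ[k] k) (b : H) :
    mulEv B ((a ⊗ₜ v) ⊗ₜ ambientLeftCoaction (k := k) (f ⊗ₜ[k] b)) = f v • B.mul a b := by
  obtain ⟨n, b1, b2, hb⟩ := exists_fin_sum_tmul (Coalgebra.comul (R := k) b)
  rw [ambientLeftCoaction_tmul, hb]
  conv_rhs => rw [← sum_counit_smul_of_comul_eq' hb]
  simp [TensorProduct.tmul_sum, Finset.smul_sum, mul_smul]

/-- The map `((a ⊗ x) ⊗ (b ⊗ v)) ↦ ab ⊗ (x ⊗ v)`, part of the diagonal coaction. -/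
noncomputable def mulTensor (B : CoquasiBialgebra k H) (X V : Type*) [AddCommMonoid X] [Module k X]
    [AddCommMonoid V] [Module k V] :
    (H ⊗[k] X) ⊗[k] (H ⊗[k] V) →ₗ[k] H ⊗[k] (X ⊗[k] V) :=
  LinearMap.rTensor (X ⊗[k] V) (TensorProduct.lift B.mul) ∘ₗ
    (TensorProduct.tensorTensorTensorComm k H X H V).toLinearMap

@[simp]
theorem mulTensor_tmul (B : CoquasiBialgebra k H) {X V : Type*} [AddCommMonoid X] [Module k X]
    [AddCommMonoid V] [Module k V] (a : H) (x : X) (b : H) (v : V) :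
    mulTensor B X V ((a ⊗ₜ x) ⊗ₜ (b ⊗ₜ v)) = B.mul a b ⊗ₜ (x ⊗ₜ v) := by
  simp [mulTensor]

theorem mulTensor_ambientLeftCoaction_tmul (B : CoquasiBialgebra k H) (f : V →ₗ[k] k)
    (d h : H) (v : V) :
    mulTensor B _ V (ambientLeftCoaction (k := k) (f ⊗ₜ[k] d) ⊗ₜ (h ⊗ₜ v)) =
      LinearMap.lTensor H ((TensorProduct.mk k _ V).flip v ∘ₗ TensorProduct.mk k _ H f)
        (LinearMap.rTensor H (B.mul.flip h) (Coalgebra.comul (R := k) d)) := by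
  rw [ambientLeftCoaction_tmul]
  induction Coalgebra.comul (R := k) d with
  | zero => simp
  | add x y hx hy => simp only [map_add, TensorProduct.add_tmul, hx, hy]
  | tmul x y => simp

/-- The map `(a ⊗ v) ⊗ ((b ⊗ x) ⊗ (c ⊗ w)) ↦ (ω(a ⊗ b ⊗ c) ev(v ⊗ x)) • w`. -/
noncomputable def evAssocInv (B : CoquasiBialgebra k H) :
    (H ⊗[k] V) ⊗[k] ((H ⊗[k] ((V →ₗ[k] k) ⊗[k] H)) ⊗[k] (H ⊗[k] V)) →ₗ[k] V :=
  (TensorProduct.lid k V).toLinearMap ∘ₗ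
    TensorProduct.map (CoquasiBialgebra.uncurry₃ B.ω)
      ((TensorProduct.lid k V).toLinearMap ∘ₗ LinearMap.rTensor V ambientEv ∘ₗ
        (TensorProduct.assoc k V ((V →ₗ[k] k) ⊗[k] H) V).symm.toLinearMap) ∘ₗ
    (TensorProduct.tensorTensorTensorComm k H V (H ⊗[k] H)
      (((V →ₗ[k] k) ⊗[k] H) ⊗[k] V)).toLinearMap ∘ₗ
    LinearMap.lTensor (H ⊗[k] V)
      (TensorProduct.tensorTensorTensorComm k H ((V →ₗ[k] k) ⊗[k] H) H V).toLinearMap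

@[simp]
theorem evAssocInv_tmul (B : CoquasiBialgebra k H) (a b c : H) (v w : V)
    (x : (V →ₗ[k] k) ⊗[k] H) :
    evAssocInv B ((a ⊗ₜ v) ⊗ₜ ((b ⊗ₜ x) ⊗ₜ (c ⊗ₜ w))) =
      (B.ω a b c * ambientEv (v ⊗ₜ x)) • w := by
  simp [evAssocInv, smul_smul, mul_comm]

theorem evAssocInv_ambientLeftCoaction_tmul (B : CoquasiBialgebra k H) (a d c : H) (v w : V)
    (f : V →ₗ[k] k) :
    evAssocInv B ((a ⊗ₜ v) ⊗ₜ (ambientLeftCoaction (k := k) (f ⊗ₜ[k] d) ⊗ₜ (c ⊗ₜ w))) =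
      (B.ω a d c * f v) • w := by
  obtain ⟨n, d1, d2, hd⟩ := exists_fin_sum_tmul (Coalgebra.comul (R := k) d)
  rw [ambientLeftCoaction_tmul, hd]
  have h := sum_mul_counit_of_comul_eq ((B.ω a).flip c) hd
  simp only [LinearMap.flip_apply] at h
  rw [← h]
  simp only [map_sum, LinearMap.lTensor_tmul, TensorProduct.mk_apply, TensorProduct.sum_tmul,
    TensorProduct.tmul_sum, evAssocInv_tmul, ambientEv_tmul, Finset.sum_mul, Finset.sum_smul]
  refine Finset.sum_congr rfl fun i _ => ?_
  congr 1
  ring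

/-- The map `((a ⊗ x) ⊗ (b ⊗ v)) ⊗ (c ⊗ y) ↦ (ω⁻¹(a ⊗ b ⊗ c) ev(v ⊗ y)) • x`. -/
noncomputable def evAssoc (B : CoquasiBialgebra k H) :
    ((H ⊗[k] ((V →ₗ[k] k) ⊗[k] H)) ⊗[k] (H ⊗[k] V)) ⊗[k]
      (H ⊗[k] ((V →ₗ[k] k) ⊗[k] H)) →ₗ[k] (V →ₗ[k] k) ⊗[k] H :=
  (TensorProduct.lid k _).toLinearMap ∘ₗ
    TensorProduct.map
      (CoquasiBialgebra.uncurry₃ B.ωInv ∘ₗ (TensorProduct.assoc k H H H).toLinearMap)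
      ((TensorProduct.rid k _).toLinearMap ∘ₗ LinearMap.lTensor _ ambientEv ∘ₗ
        (TensorProduct.assoc k ((V →ₗ[k] k) ⊗[k] H) V ((V →ₗ[k] k) ⊗[k] H)).toLinearMap) ∘ₗ
    (TensorProduct.tensorTensorTensorComm k (H ⊗[k] H) (((V →ₗ[k] k) ⊗[k] H) ⊗[k] V)
      H ((V →ₗ[k] k) ⊗[k] H)).toLinearMap ∘ₗ
    LinearMap.rTensor (H ⊗[k] ((V →ₗ[k] k) ⊗[k] H))
      (TensorProduct.tensorTensorTensorComm k H ((V →ₗ[k] k) ⊗[k] H) H V).toLinearMap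

@[simp]
theorem evAssoc_tmul (B : CoquasiBialgebra k H) (a b c : H) (v : V)
    (x y : (V →ₗ[k] k) ⊗[k] H) :
    evAssoc B (((a ⊗ₜ x) ⊗ₜ (b ⊗ₜ v)) ⊗ₜ (c ⊗ₜ y)) =
      (B.ωInv a b c * ambientEv (v ⊗ₜ y)) • x := by
  simp [evAssoc, smul_smul, mul_comm]

theorem evAssoc_ambientLeftCoaction_tmul (B : CoquasiBialgebra k H) (d c b : H) (w : V)
    (f g : V →ₗ[k] k) :
    evAssoc B ((ambientLeftCoaction (k := k) (f ⊗ₜ[k] d) ⊗ₜ (c ⊗ₜ w)) ⊗ₜ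
        ambientLeftCoaction (k := k) (g ⊗ₜ[k] b)) =
      g w • (f ⊗ₜ[k] TensorProduct.lid k H (LinearMap.rTensor H ((B.ωInv.flip c).flip b)
        (Coalgebra.comul (R := k) d))) := by
  obtain ⟨n, b1, b2, hb⟩ := exists_fin_sum_tmul (Coalgebra.comul (R := k) b)
  rw [ambientLeftCoaction_tmul, ambientLeftCoaction_tmul]
  induction Coalgebra.comul (R := k) d with
  | zero => simp
  | add x y hx hy =>
    simp only [map_add, TensorProduct.add_tmul, TensorProduct.tmul_add, smul_add, hx, hy]
  | tmul x y =>
    have h := sum_mul_counit_of_comul_eq (B.ωInv x c) hb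
    simp only [LinearMap.rTensor_tmul, LinearMap.flip_apply, TensorProduct.lid_tmul, hb, map_sum,
      LinearMap.lTensor_tmul, TensorProduct.mk_apply, TensorProduct.tmul_sum, evAssoc_tmul,
      ambientEv_tmul, ← h, Finset.sum_smul, Finset.smul_sum, TensorProduct.tmul_smul, smul_smul]
    refine Finset.sum_congr rfl fun i _ => ?_
    congr 1
    ring

variable {n : ℕ} (β : Module.Basis (Fin n) k V) {ρ : V →ₗ[k] H ⊗[k] V}
  {ρdual : (V →ₗ[k] k) →ₗ[k] (V →ₗ[k] k) ⊗[k] H} {c : Fin n → Fin n → H}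

theorem exists_coord_of_mem_coinvariants (B : CoquasiBialgebra k H)
    (hρdual : ∀ j, ρdual (β.coord j) = ∑ i, β.coord i ⊗ₜ[k] c i j)
    {x : (V →ₗ[k] k) ⊗[k] H} (hx : x ∈ coinvariants B ρdual) :
    ∃ b : Fin n → H, x = ∑ i, β.coord i ⊗ₜ[k] b i ∧
      ∀ l, ∑ i, LinearMap.lTensor H (B.mul (c l i)) (Coalgebra.comul (R := k) (b i)) =
        b l ⊗ₜ[k] B.one := by
  have h := (sum_coord_tmul_lid β x).symm
  exact ⟨_, h, (sum_coord_tmul_mem_coinvariants_iff β B hρdual _).mp (h ▸ hx)⟩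

/-- If `∑ i, b i₁ ⊗ c l i * b i₂ = b l ⊗ 1`, then `∑ i, c l i * b i = ε(b l) • 1`. -/
theorem sum_mul_eq_counit_smul_one (B : CoquasiBialgebra k H) {α : Type*} [Fintype α]
    {c b : α → H} {d : H}
    (hb : ∑ i, LinearMap.lTensor H (B.mul (c i)) (Coalgebra.comul (R := k) (b i)) =
      d ⊗ₜ[k] B.one) :
    ∑ i, B.mul (c i) (b i) = Coalgebra.counit (R := k) d • B.one := by
  have h := congrArg (fun t => TensorProduct.lid k H
    (LinearMap.rTensor H (Coalgebra.counit (R := k) (A := H)) t)) hb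
  simp only [map_sum, LinearMap.rTensor_tmul, TensorProduct.lid_tmul] at h
  rw [← h]
  refine Finset.sum_congr rfl fun i _ => ?_
  obtain ⟨m, b1, b2, hb12⟩ := exists_fin_sum_tmul (Coalgebra.comul (R := k) (b i))
  conv_lhs => rw [← sum_counit_smul_of_comul_eq hb12]
  simp [hb12]

theorem mulEv_coaction (B : CoquasiBialgebra k H)
    (hρ : ∀ i, ρ (β i) = ∑ j, c i j ⊗ₜ[k] β j)
    (hρdual : ∀ j, ρdual (β.coord j) = ∑ i, β.coord i ⊗ₜ[k] c i j)
    (v : V) {x : (V →ₗ[k] k) ⊗[k] H} (hx : x ∈ coinvariants B ρdual) :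
    mulEv B (ρ v ⊗ₜ ambientLeftCoaction (k := k) x) = ambientEv (v ⊗ₜ[k] x) • B.one := by
  obtain ⟨b, rfl, hb⟩ := exists_coord_of_mem_coinvariants β B hρdual hx
  have key (l : Fin n) : mulEv B (ρ (β l) ⊗ₜ ambientLeftCoaction (k := k)
      (∑ i, β.coord i ⊗ₜ[k] b i)) = ambientEv (β l ⊗ₜ ∑ i, β.coord i ⊗ₜ[k] b i) • B.one := by
    simp only [hρ, map_sum, TensorProduct.tmul_sum, TensorProduct.sum_tmul,
      mulEv_ambientLeftCoaction_tmul, ambientEv_tmul]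
    simp [Finsupp.single_apply, sum_mul_eq_counit_smul_one B (hb l)]
  have hlin : mulEv B ∘ₗ (TensorProduct.mk k _ _).flip
      (ambientLeftCoaction (k := k) (∑ i, β.coord i ⊗ₜ[k] b i)) ∘ₗ ρ =
      (LinearMap.toSpanSingleton k H B.one) ∘ₗ ambientEv ∘ₗ
        (TensorProduct.mk k V _).flip (∑ i, β.coord i ⊗ₜ[k] b i) :=
    β.ext key
  exact LinearMap.congr_fun hlin v

variable {S : H →ₗ[k] H}

theorem sum_coord_tmul_preantipode_mem_coinvariants {B : CoquasiBialgebra k H}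
    (hS : B.IsPreantipode S)
    (hc : ∀ i j, Coalgebra.comul (R := k) (c i j) = ∑ l, c i l ⊗ₜ[k] c l j)
    (hρdual : ∀ j, ρdual (β.coord j) = ∑ i, β.coord i ⊗ₜ[k] c i j) (j : Fin n) :
    ∑ i, β.coord i ⊗ₜ[k] S (c i j) ∈ coinvariants B ρdual :=
  (sum_coord_tmul_mem_coinvariants_iff β B hρdual _).mpr fun l => hS.sum_lTensor B hc l j

theorem mulTensor_coaction {B : CoquasiBialgebra k H} (hS : B.IsPreantipode S)
    (hc : ∀ i j, Coalgebra.comul (R := k) (c i j) = ∑ l, c i l ⊗ₜ[k] c l j)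
    (hρ : ∀ i, ρ (β i) = ∑ j, c i j ⊗ₜ[k] β j) :
    (mulTensor B _ V) (TensorProduct.map (ambientLeftCoaction (k := k)) ρ
      (∑ j, (∑ i, β.coord i ⊗ₜ[k] S (c i j)) ⊗ₜ[k] β j)) =
      B.one ⊗ₜ ∑ j, (∑ i, β.coord i ⊗ₜ[k] S (c i j)) ⊗ₜ[k] β j := by
  simp only [map_sum, TensorProduct.map_tmul, hρ, TensorProduct.sum_tmul, TensorProduct.tmul_sum,
    mulTensor_ambientLeftCoaction_tmul]
  refine (Finset.sum_congr rfl fun s _ => Finset.sum_comm).trans (Finset.sum_comm.trans ?_)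
  refine Finset.sum_congr rfl fun t _ => Finset.sum_comm.trans ?_
  refine Finset.sum_congr rfl fun i _ => ?_
  rw [← map_sum, hS.sum_rTensor B hc]
  simp

theorem evAssocInv_coaction {B : CoquasiBialgebra k H} (hS : B.IsPreantipode S)
    (hc : ∀ i j, Coalgebra.comul (R := k) (c i j) = ∑ l, c i l ⊗ₜ[k] c l j)
    (hε : ∀ i j, Coalgebra.counit (R := k) (c i j) = if i = j then 1 else 0)
    (hρ : ∀ i, ρ (β i) = ∑ j, c i j ⊗ₜ[k] β j) (v : V) :
    evAssocInv B (ρ v ⊗ₜ TensorProduct.map (ambientLeftCoaction (k := k)) ρ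
      (∑ j, (∑ i, β.coord i ⊗ₜ[k] S (c i j)) ⊗ₜ[k] β j)) = v := by
  have key (l : Fin n) : evAssocInv B (ρ (β l) ⊗ₜ TensorProduct.map (ambientLeftCoaction (k := k)) ρ
      (∑ j, (∑ i, β.coord i ⊗ₜ[k] S (c i j)) ⊗ₜ[k] β j)) = β l := by
    simp only [hρ, map_sum,
      TensorProduct.tmul_sum, TensorProduct.sum_tmul, TensorProduct.map_tmul,
      evAssocInv_ambientLeftCoaction_tmul]
    calc _ = ∑ r, (∑ i, ∑ t, B.ω (c l i) (S (c i t)) (c t r)) • β r := by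
          simp only [Finset.sum_smul]
          rw [Finset.sum_congr rfl fun t _ => Finset.sum_comm, Finset.sum_comm]
          refine Finset.sum_congr rfl fun r _ => ?_
          rw [Finset.sum_comm]
          simp [Finsupp.single_apply]
      _ = _ := by simp [hS.sum_ω B hc, hε]
  have hlin : evAssocInv B ∘ₗ (TensorProduct.mk k _ _).flip
      (TensorProduct.map (ambientLeftCoaction (k := k)) ρ
        (∑ j, (∑ i, β.coord i ⊗ₜ[k] S (c i j)) ⊗ₜ[k] β j)) ∘ₗ ρ = LinearMap.id :=
    β.ext key
  exact LinearMap.congr_fun hlin v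

theorem evAssoc_coaction {B : CoquasiBialgebra k H} (hS : B.IsPreantipode S)
    (hc : ∀ i j, Coalgebra.comul (R := k) (c i j) = ∑ l, c i l ⊗ₜ[k] c l j)
    (hε : ∀ i j, Coalgebra.counit (R := k) (c i j) = if i = j then 1 else 0)
    (hρ : ∀ i, ρ (β i) = ∑ j, c i j ⊗ₜ[k] β j)
    (hρdual : ∀ j, ρdual (β.coord j) = ∑ i, β.coord i ⊗ₜ[k] c i j)
    {x : (V →ₗ[k] k) ⊗[k] H} (hx : x ∈ coinvariants B ρdual) :
    evAssoc B (TensorProduct.map (ambientLeftCoaction (k := k)) ρ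
      (∑ j, (∑ i, β.coord i ⊗ₜ[k] S (c i j)) ⊗ₜ[k] β j) ⊗ₜ
        ambientLeftCoaction (k := k) x) = x := by
  obtain ⟨b, rfl, hb⟩ := exists_coord_of_mem_coinvariants β B hρdual hx
  simp only [map_sum, TensorProduct.tmul_sum, TensorProduct.sum_tmul, TensorProduct.map_tmul, hρ,
    evAssoc_ambientLeftCoaction_tmul]
  calc _ = ∑ i, β.coord i ⊗ₜ[k] ∑ s, ∑ r, TensorProduct.lid k H
        (LinearMap.rTensor H ((B.ωInv.flip (c s r)).flip (b r))
          (Coalgebra.comul (R := k) (S (c i s)))) := by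
        simp only [TensorProduct.tmul_sum]
        rw [Finset.sum_comm, Finset.sum_congr rfl fun s _ => Finset.sum_comm, Finset.sum_comm]
        refine Finset.sum_congr rfl fun i _ => Finset.sum_congr rfl fun s _ => ?_
        simp [Finsupp.single_apply]
    _ = _ := by simp only [hS.sum_ωInv_smul B hc hε hb]

end Duality

/-- Let `k` be a field, `H` a coquasi-bialgebra with preantipode `S` and
`V` a finite-dimensional left `H`-comodule with dual basis `∑ᵢ vⁱ ⊗ vᵢ`.  Then, with
`V^⋆ := (V* ⊗ H)^{coH}`: (a) `ρ_{V^⋆}(∑ f_t ⊗ b_t) = ∑ (b_t)₁ ⊗ (f_t ⊗ (b_t)₂)` is a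
well-defined left `H`-comodule structure on `V^⋆`; (b) the element
`db_V(1) = ∑ᵢ (vⁱ₀ ⊗ S(vⁱ₁)) ⊗ vᵢ` lies in `V^⋆ ⊗ V`, and `ev_V : u ⊗ (∑ f_t ⊗ b_t) ↦
∑ f_t(u) ε(b_t)` and `db_V` are morphisms of left `H`-comodules; (c) the zig-zag identities
hold with respect to the `ω⁻¹`-twisted associator, so `V^⋆` is a right dual of `V` in the
monoidal category of finite-dimensional left `H`-comodules. -/
theorem comodule_right_dual (B : CoquasiBialgebra k H) (S : H →ₗ[k] H)
    (hS : B.IsPreantipode S)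
    (V : Type*) [AddCommGroup V] [Module k V] [FiniteDimensional k V]
    -- the left `H`-comodule structure on `V`
    (ρ : V →ₗ[k] H ⊗[k] V)
    (hρ_coassoc : LinearMap.rTensor V (Coalgebra.comul (R := k) (A := H)) ∘ₗ ρ =
      (TensorProduct.assoc k H H V).symm.toLinearMap ∘ₗ LinearMap.lTensor H ρ ∘ₗ ρ)
    (hρ_counit : (TensorProduct.lid k V).toLinearMap ∘ₗ
      LinearMap.rTensor V (Coalgebra.counit (R := k) (A := H)) ∘ₗ ρ = LinearMap.id)
    -- a dual basis `∑ᵢ vⁱ ⊗ vᵢ ∈ V* ⊗ V`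
    (ι : Type*) [Fintype ι] (e : ι → V) (e' : ι → V →ₗ[k] k)
    (hdual : ∀ v : V, ∑ i, e' i v • e i = v)
    -- the right `H`-coaction on `V*`, determined by `∑ f₀(v) f₁ = ∑ v₋₁ f(v₀)`
    (ρdual : (V →ₗ[k] k) →ₗ[k] (V →ₗ[k] k) ⊗[k] H)
    (hρdual : ∀ (f : V →ₗ[k] k) (v : V) (n m : ℕ)
      (f0 : Fin n → V →ₗ[k] k) (f1 : Fin n → H) (vm : Fin m → H) (v0 : Fin m → V),
      ρdual f = ∑ t, f0 t ⊗ₜ[k] f1 t → ρ v = ∑ s, vm s ⊗ₜ[k] v0 s →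
      ∑ t, f0 t v • f1 t = ∑ s, f (v0 s) • vm s) :
    -- (a) the corestricted coaction is a well-defined comodule structure on `V^⋆`
    ∃ ρ' : (coinvariants B ρdual (V := V)) →ₗ[k] H ⊗[k] (coinvariants B ρdual (V := V)),
      (∀ (x : coinvariants B ρdual (V := V)) (n : ℕ)
        (f : Fin n → V →ₗ[k] k) (b : Fin n → H) (m : Fin n → ℕ)
        (b1 b2 : ∀ t, Fin (m t) → H),
        (x : (V →ₗ[k] k) ⊗[k] H) = ∑ t, f t ⊗ₜ[k] b t →
        (∀ t, Coalgebra.comul (R := k) (b t) = ∑ p, b1 t p ⊗ₜ[k] b2 t p) →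
        LinearMap.lTensor H (coinvariants B ρdual (V := V)).subtype (ρ' x) =
          ∑ t, ∑ p, b1 t p ⊗ₜ[k] (f t ⊗ₜ[k] b2 t p)) ∧
      (LinearMap.rTensor _ (Coalgebra.comul (R := k) (A := H)) ∘ₗ ρ' =
        (TensorProduct.assoc k H H _).symm.toLinearMap ∘ₗ LinearMap.lTensor H ρ' ∘ₗ ρ') ∧
      ((TensorProduct.lid k _).toLinearMap ∘ₗ
        LinearMap.rTensor _ (Coalgebra.counit (R := k) (A := H)) ∘ₗ ρ' = LinearMap.id) ∧
      -- (b) the dual basis element lies in `V^⋆ ⊗ V`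
      (∑ i, (LinearMap.lTensor (V →ₗ[k] k) S) (ρdual (e' i)) ⊗ₜ[k] e i ∈
        LinearMap.range (LinearMap.rTensor V (coinvariants B ρdual (V := V)).subtype)) ∧
      -- (b) `ev` is a morphism of left `H`-comodules
      (∀ (v : V) (x : (V →ₗ[k] k) ⊗[k] H), x ∈ coinvariants B ρdual (V := V) →
        ∀ (m n : ℕ) (vm : Fin m → H) (v0 : Fin m → V)
          (xm : Fin n → H) (x0 : Fin n → (V →ₗ[k] k) ⊗[k] H),
        ρ v = ∑ s, vm s ⊗ₜ[k] v0 s →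
        ambientLeftCoaction (k := k) x = ∑ t, xm t ⊗ₜ[k] x0 t →
        ∑ s, ∑ t, ambientEv (v0 s ⊗ₜ[k] x0 t) • B.mul (vm s) (xm t) =
          ambientEv (v ⊗ₜ[k] x) • B.one) ∧
      -- (b) `db` is a morphism of left `H`-comodules
      (∀ (N : ℕ) (g : Fin N → (V →ₗ[k] k) ⊗[k] H) (w : Fin N → V)
        (m m' : Fin N → ℕ) (gm : ∀ t, Fin (m t) → H)
        (g0 : ∀ t, Fin (m t) → (V →ₗ[k] k) ⊗[k] H)
        (wm : ∀ t, Fin (m' t) → H) (w0 : ∀ t, Fin (m' t) → V),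
        (∑ i, (LinearMap.lTensor (V →ₗ[k] k) S) (ρdual (e' i)) ⊗ₜ[k] e i =
          ∑ t, g t ⊗ₜ[k] w t) →
        (∀ t, ambientLeftCoaction (k := k) (g t) = ∑ p, gm t p ⊗ₜ[k] g0 t p) →
        (∀ t, ρ (w t) = ∑ q, wm t q ⊗ₜ[k] w0 t q) →
        ∑ t, ∑ p, ∑ q, B.mul (gm t p) (wm t q) ⊗ₜ[k] (g0 t p ⊗ₜ[k] w0 t q) =
          B.one ⊗ₜ[k] ∑ t, g t ⊗ₜ[k] w t) ∧
      -- (c) first zig-zag identity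
      (∀ (v : V) (N : ℕ) (g : Fin N → (V →ₗ[k] k) ⊗[k] H) (w : Fin N → V)
        (nv : ℕ) (vm : Fin nv → H) (v0 : Fin nv → V)
        (m m' : Fin N → ℕ) (gm : ∀ t, Fin (m t) → H)
        (g0 : ∀ t, Fin (m t) → (V →ₗ[k] k) ⊗[k] H)
        (wm : ∀ t, Fin (m' t) → H) (w0 : ∀ t, Fin (m' t) → V),
        ρ v = ∑ s, vm s ⊗ₜ[k] v0 s →
        (∑ i, (LinearMap.lTensor (V →ₗ[k] k) S) (ρdual (e' i)) ⊗ₜ[k] e i =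
          ∑ t, g t ⊗ₜ[k] w t) →
        (∀ t, ambientLeftCoaction (k := k) (g t) = ∑ p, gm t p ⊗ₜ[k] g0 t p) →
        (∀ t, ρ (w t) = ∑ q, wm t q ⊗ₜ[k] w0 t q) →
        ∑ s, ∑ t, ∑ p, ∑ q,
          (B.ω (vm s) (gm t p) (wm t q) * ambientEv (v0 s ⊗ₜ[k] g0 t p)) • w0 t q = v) ∧
      -- (c) second zig-zag identity
      (∀ (x : (V →ₗ[k] k) ⊗[k] H), x ∈ coinvariants B ρdual (V := V) →
        ∀ (N : ℕ) (g : Fin N → (V →ₗ[k] k) ⊗[k] H) (w : Fin N → V)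
        (nx : ℕ) (xm : Fin nx → H) (x0 : Fin nx → (V →ₗ[k] k) ⊗[k] H)
        (m m' : Fin N → ℕ) (gm : ∀ t, Fin (m t) → H)
        (g0 : ∀ t, Fin (m t) → (V →ₗ[k] k) ⊗[k] H)
        (wm : ∀ t, Fin (m' t) → H) (w0 : ∀ t, Fin (m' t) → V),
        ambientLeftCoaction (k := k) x = ∑ r, xm r ⊗ₜ[k] x0 r →
        (∑ i, (LinearMap.lTensor (V →ₗ[k] k) S) (ρdual (e' i)) ⊗ₜ[k] e i =
          ∑ t, g t ⊗ₜ[k] w t) →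
        (∀ t, ambientLeftCoaction (k := k) (g t) = ∑ p, gm t p ⊗ₜ[k] g0 t p) →
        (∀ t, ρ (w t) = ∑ q, wm t q ⊗ₜ[k] w0 t q) →
        ∑ t, ∑ p, ∑ q, ∑ r,
          (B.ωInv (gm t p) (wm t q) (xm r) * ambientEv (w0 t q ⊗ₜ[k] x0 r)) • g0 t p = x) := by
  let β := Module.finBasis k V
  have hρ := coaction_basis β ρ
  have hc := comul_coactionMatrix β hρ_coassoc
  have hε := counit_coactionMatrix β hρ_counit
  have hd := dualCoaction_coord β hρdual
  have hD : ∑ i, (LinearMap.lTensor (V →ₗ[k] k) S) (ρdual (e' i)) ⊗ₜ[k] e i =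
      ∑ j, (∑ i, β.coord i ⊗ₜ[k] S (coactionMatrix β ρ i j)) ⊗ₜ[k] β j := by
    refine (sum_dualBasis_eq β hdual (LinearMap.lTensor (V →ₗ[k] k) S ∘ₗ ρdual)).trans ?_
    refine Finset.sum_congr rfl fun j _ => ?_
    rw [LinearMap.comp_apply, hd, map_sum]
    simp only [LinearMap.lTensor_tmul]
  obtain ⟨ρ', hρ', hcoassoc, hcounit⟩ := exists_coinvariants_coaction B ρdual
  refine ⟨ρ', ?_, hcoassoc, hcounit, ?_, ?_, ?_, ?_, ?_⟩
  · intro x n f b m b1 b2 hx hb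
    rw [hρ', hx, map_sum]
    simp only [ambientLeftCoaction_tmul, hb, map_sum, LinearMap.lTensor_tmul,
      TensorProduct.mk_apply]
  · rw [hD]
    refine ⟨∑ j, ⟨_, sum_coord_tmul_preantipode_mem_coinvariants β hS hc hd j⟩ ⊗ₜ β j, ?_⟩
    rw [map_sum]
    rfl
  · intro v x hx m n vm v0 xm x0 hv hLx
    rw [← mulEv_coaction β B hρ hd v hx, hv, hLx]
    simp only [TensorProduct.sum_tmul, TensorProduct.tmul_sum, map_sum, mulEv_tmul]
    exact Finset.sum_comm
  · intro N g w m m' gm g0 wm w0 hg hL hw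
    have h := mulTensor_coaction β hS hc hρ
    rw [← hD, hg] at h
    rw [← h]
    simp only [map_sum, TensorProduct.map_tmul, hL, hw, TensorProduct.sum_tmul,
      TensorProduct.tmul_sum, mulTensor_tmul]
    exact Finset.sum_congr rfl fun t _ => Finset.sum_comm
  · intro v N g w nv vm v0 m m' gm g0 wm w0 hv hg hL hw
    have h := evAssocInv_coaction β hS hc hε hρ v
    rw [← hD, hg, hv] at h
    refine Eq.trans ?_ h
    simp only [map_sum, TensorProduct.map_tmul, hL, hw, TensorProduct.sum_tmul,
      TensorProduct.tmul_sum, evAssocInv_tmul]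
    rw [Finset.sum_comm]
    refine Finset.sum_congr rfl fun t _ => ?_
    rw [Finset.sum_congr rfl fun s _ => Finset.sum_comm, Finset.sum_comm]
    exact Finset.sum_congr rfl fun q _ => Finset.sum_comm
  · intro x hx N g w nx xm x0 m m' gm g0 wm w0 hLx hg hL hw
    have h := evAssoc_coaction β hS hc hε hρ hd hx
    rw [← hD, hg, hLx] at h
    refine Eq.trans ?_ h
    simp only [map_sum, TensorProduct.map_tmul, hL, hw, TensorProduct.sum_tmul,
      TensorProduct.tmul_sum, evAssoc_tmul]
    rw [eq_comm, Finset.sum_comm]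
    refine Finset.sum_congr rfl fun t _ => ?_
    rw [Finset.sum_comm, Finset.sum_congr rfl fun q _ => Finset.sum_comm, Finset.sum_comm]

end Statement16
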